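/- arXiv:0711.2684 — 9 statements merged into one kernel-verified Lean document; each statement's English description precedes it below -/
import Mathlib

section
/- The LRMax code is a bijection from the set of 321-avoiding permutations of {1,...,n} onto the set of pairs of integer sequences ((A_i)_{i=1}^r,(D_i)_{i=1}^r) satisfying: 0 ≤ r ≤ n-1, 1 ≤ A_1 < ... < A_r ≤ n-1, 1 ≤ D_1 < ... < D_r ≤ n-1, and A_i ≥ D_i for all 1 ≤ i ≤ r. -/
/-- `π : ℕ → ℕ` represents a permutation of `{1, …, n}` (and is the identity elsewhere). -/
def PermOn (n : ℕ) (π : ℕ → ℕ) : Prop :=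
  Set.BijOn π (Set.Icc 1 n) (Set.Icc 1 n) ∧ ∀ i, i ∉ Set.Icc 1 n → π i = i

/-- `π` is 321-avoiding: there are no `i < j < k` in `{1, …, n}` with `π k < π j < π i`. -/
def Av321 (n : ℕ) (π : ℕ → ℕ) : Prop :=
  ∀ i j k : ℕ, 1 ≤ i → i < j → j < k → k ≤ n → ¬(π k < π j ∧ π j < π i)

/-- The value `π i` is a left-to-right maximum of `π`. -/
def IsLRMax (π : ℕ → ℕ) (i : ℕ) : Prop := ∀ j, 1 ≤ j → j < i → π j < π i

/-- The conditions (2) for a valid partial-sum ascent-descent code of size `n`: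
`0 ≤ r ≤ n - 1`, `1 ≤ A_1 < … < A_r ≤ n - 1`, `1 ≤ D_1 < … < D_r ≤ n - 1`, and
`A_i ≥ D_i` for `1 ≤ i ≤ r`. -/
def ValidCode (n : ℕ) (A D : List ℕ) : Prop :=
  A.length = D.length ∧ A.length ≤ n - 1 ∧
  A.Chain' (· < ·) ∧ D.Chain' (· < ·) ∧
  (∀ x ∈ A, 1 ≤ x ∧ x ≤ n - 1) ∧ (∀ x ∈ D, 1 ≤ x ∧ x ≤ n - 1) ∧
  (∀ i, i < A.length → D.getD i 0 ≤ A.getD i 0)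

/-- The positions of the left-to-right maxima of `π`, in increasing order. -/
def lrMaxPositions (n : ℕ) (π : ℕ → ℕ) : List ℕ :=
  (List.range' 1 n).filter (fun i => (List.range' 1 (i-1)).all (fun j => decide (π j < π i)))

/-- The LRMax code `(A, D)` of a permutation of `{1, …, n}` with left-to-right maxima
`m_1 < … < m_k` at positions `p_1 < … < p_k`: `A_i = m_i` and `D_i = p_{i+1} - 1` for
`1 ≤ i ≤ r = k - 1`. -/
def lrMaxCode (n : ℕ) (π : ℕ → ℕ) : List ℕ × List ℕ :=
  (((lrMaxPositions n π).map π).dropLast, ((lrMaxPositions n π).drop 1).map (· - 1))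

section StrictlySortedLists

theorem eq_of_pairwise_lt_of_mem_iff {l l' : List ℕ} (hl : l.Pairwise (· < ·))
    (hl' : l'.Pairwise (· < ·)) (h : ∀ x, x ∈ l ↔ x ∈ l') : l = l' :=
  List.Perm.eq_of_pairwise (le := (· < ·)) (fun _ _ _ _ hab hba => absurd hab (lt_asymm hba)) hl hl'
    ((List.perm_ext_iff_of_nodup (hl.imp ne_of_lt) (hl'.imp ne_of_lt)).2 h)

theorem dropLast_append_singleton_of_isGreatest {l : List ℕ} (hl : l.Pairwise (· < ·)) {x : ℕ}
    (hx : x ∈ l) (hmax : ∀ y ∈ l, y ≤ x) : l.dropLast ++ [x] = l := by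
  have hne : l ≠ [] := List.ne_nil_of_mem hx
  have hlast : l.getLast hne = x := by
    refine le_antisymm (hmax _ (List.getLast_mem hne)) ?_
    rw [← List.dropLast_append_getLast hne] at hl hx
    rw [List.pairwise_append] at hl
    rcases List.mem_append.1 hx with h | h
    · exact (hl.2.2 x h _ (List.mem_singleton_self _)).le
    · exact (List.mem_singleton.1 h).le
  rw [← hlast, List.dropLast_append_getLast]

theorem cons_tail_of_isLeast {l : List ℕ} (hl : l.Pairwise (· < ·)) {x : ℕ}
    (hx : x ∈ l) (hmin : ∀ y ∈ l, x ≤ y) : x :: l.tail = l := by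
  cases l with
  | nil => simp at hx
  | cons a t =>
    have := hmin a (by simp)
    rw [List.pairwise_cons] at hl
    rcases List.mem_cons.1 hx with h | h
    · simp [h]
    · have := hl.1 x h
      omega

theorem count_mem_getElem {l : List ℕ} (hl : l.Pairwise (· < ·)) {j : ℕ} (hj : j < l.length) :
    Nat.count (· ∈ l) l[j] = j := by
  rw [List.pairwise_iff_getElem] at hl
  have himage : {x ∈ Finset.range l[j] | x ∈ l} =
      (Finset.univ : Finset (Fin j)).image (fun i => l[i.1]'(i.2.trans hj)) := by
    ext x
    simp only [Finset.mem_filter, Finset.mem_range, Finset.mem_image, Finset.mem_univ, true_and]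
    constructor
    · rintro ⟨hx, hmem⟩
      obtain ⟨i, hi, rfl⟩ := List.mem_iff_getElem.1 hmem
      refine ⟨⟨i, ?_⟩, rfl⟩
      by_contra hij
      rcases (not_lt.1 hij).eq_or_lt with h | h
      · subst h; exact lt_irrefl _ hx
      · exact lt_asymm hx (hl j i hj hi h)
    · rintro ⟨i, rfl⟩
      exact ⟨hl _ _ _ hj i.2, List.getElem_mem _⟩
  rw [Nat.count_eq_card_filter_range, himage, Finset.card_image_of_injective, Finset.card_fin]
  intro a b hab
  by_contra hne
  rcases lt_or_gt_of_ne (Fin.val_ne_of_ne hne) with h | h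
  · exact (hl _ _ (a.2.trans hj) (b.2.trans hj) h).ne hab
  · exact (hl _ _ (b.2.trans hj) (a.2.trans hj) h).ne hab.symm

theorem count_mem_le_length (l : List ℕ) (i : ℕ) : Nat.count (· ∈ l) i ≤ l.length := by
  rw [Nat.count_eq_card_filter_range]
  refine (Finset.card_le_card (t := l.toFinset) ?_).trans l.toFinset_card_le
  intro x hx
  simpa using (Finset.mem_filter.1 hx).2

theorem getElem_lt_iff_lt_count {l : List ℕ} (hl : l.Pairwise (· < ·)) {j : ℕ}
    (hj : j < l.length) (i : ℕ) : l[j] < i ↔ j < Nat.count (· ∈ l) i := by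
  constructor
  · intro h
    have := Nat.count_strict_mono (p := (· ∈ l)) (List.getElem_mem hj) h
    rwa [count_mem_getElem hl hj] at this
  · intro h
    refine Nat.lt_of_count_lt_count (p := (· ∈ l)) ?_
    rwa [count_mem_getElem hl hj]

theorem count_mem_eq_length {l : List ℕ} (hl : l.Pairwise (· < ·)) {i : ℕ}
    (h : ∀ x ∈ l, x < i) : Nat.count (· ∈ l) i = l.length := by
  refine le_antisymm (count_mem_le_length l i) ?_
  by_contra hlt
  push Not at hlt
  exact lt_irrefl _ ((getElem_lt_iff_lt_count hl hlt i).1 (h _ (List.getElem_mem hlt)))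

theorem count_notMem_add_count_mem (l : List ℕ) (i : ℕ) :
    Nat.count (· ∉ l) i + Nat.count (· ∈ l) i = i := by
  induction i with
  | zero => simp
  | succ i ih =>
    rw [Nat.count_succ, Nat.count_succ]
    by_cases h : i ∈ l <;> simp [h] <;> omega

theorem infinite_ofPred_notMem (l : List ℕ) : (Set.ofPred (· ∉ l)).Infinite :=
  Set.Finite.infinite_compl (s := {x | x ∈ l}) l.finite_toSet

end StrictlySortedLists

section LeftToRightMaxima

variable {n : ℕ} {π σ : ℕ → ℕ}

theorem mem_lrMaxPositions {i : ℕ} :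
    i ∈ lrMaxPositions n π ↔ (1 ≤ i ∧ i ≤ n) ∧ IsLRMax π i := by
  simp only [lrMaxPositions, IsLRMax, List.mem_filter, List.mem_range'_1, List.all_eq_true,
    decide_eq_true_eq]
  constructor
  · rintro ⟨h, h'⟩
    exact ⟨by omega, fun j hj hji => h' j (by omega)⟩
  · rintro ⟨h, h'⟩
    exact ⟨by omega, fun j hj => h' j (by omega) (by omega)⟩

theorem pairwise_lrMaxPositions : (lrMaxPositions n π).Pairwise (· < ·) :=
  List.Pairwise.filter _ List.pairwise_lt_range'

theorem pairwise_map_lrMaxPositions : ((lrMaxPositions n π).map π).Pairwise (· < ·) := by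
  rw [List.pairwise_map]
  refine pairwise_lrMaxPositions.imp_of_mem fun {a b} ha hb hab => ?_
  exact (mem_lrMaxPositions.1 hb).2 a (mem_lrMaxPositions.1 ha).1.1 hab

/-- Every value is dominated by a left-to-right maximum weakly to its left. -/
theorem exists_isLRMax_le (π : ℕ → ℕ) (i : ℕ) (hi : 1 ≤ i) :
    ∃ j, 1 ≤ j ∧ j ≤ i ∧ IsLRMax π j ∧ π i ≤ π j := by
  induction i using Nat.strong_induction_on with
  | _ i ih =>
    by_cases h : IsLRMax π i
    · exact ⟨i, hi, le_rfl, h, le_rfl⟩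
    · simp only [IsLRMax] at h
      push Not at h
      obtain ⟨j, hj, hji, hle⟩ := h
      obtain ⟨k, hk, hkj, hmax, hle'⟩ := ih j hji hj
      exact ⟨k, hk, hkj.trans hji.le, hmax, hle.trans hle'⟩

theorem one_cons_tail_lrMaxPositions (hn : 1 ≤ n) :
    1 :: (lrMaxPositions n π).tail = lrMaxPositions n π :=
  cons_tail_of_isLeast pairwise_lrMaxPositions
    (mem_lrMaxPositions.2 ⟨⟨le_rfl, hn⟩, fun j _ _ => by omega⟩)
    fun _ hy => (mem_lrMaxPositions.1 hy).1.1

theorem one_cons_map_snd_lrMaxCode (hn : 1 ≤ n) :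
    1 :: (lrMaxCode n π).2.map (· + 1) = lrMaxPositions n π := by
  rw [← one_cons_tail_lrMaxPositions (π := π) hn]
  simp only [lrMaxCode, List.map_map, List.drop_one, List.cons.injEq, true_and]
  refine (List.map_congr_left fun x hx => ?_).trans (List.map_id _)
  have := (mem_lrMaxPositions.1 (List.mem_of_mem_tail hx)).1.1
  simp only [Function.comp_apply, id]
  omega

theorem fst_lrMaxCode_append (hn : 1 ≤ n) (hπ : PermOn n π) :
    (lrMaxCode n π).1 ++ [n] = (lrMaxPositions n π).map π := by
  refine dropLast_append_singleton_of_isGreatest pairwise_map_lrMaxPositions ?_ ?_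
  · obtain ⟨i, hi, hin⟩ := hπ.1.surjOn (Set.mem_Icc.2 ⟨hn, le_rfl⟩)
    obtain ⟨j, hj, hji, hmax, hle⟩ := exists_isLRMax_le π i hi.1
    have hj' : j ∈ Set.Icc 1 n := ⟨hj, hji.trans hi.2⟩
    have := (hπ.1.mapsTo hj').2
    exact List.mem_map.2 ⟨j, mem_lrMaxPositions.2 ⟨hj', hmax⟩, by omega⟩
  · intro y hy
    obtain ⟨i, hi, rfl⟩ := List.mem_map.1 hy
    exact (hπ.1.mapsTo (mem_lrMaxPositions.1 hi).1).2

theorem getElem_succ_lrMaxPositions_le (hπ : PermOn n π) {i : ℕ}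
    (hi : i + 1 < (lrMaxPositions n π).length) :
    (lrMaxPositions n π)[i + 1] - 1 ≤ π (lrMaxPositions n π)[i] := by
  set L := lrMaxPositions n π
  have hmem := mem_lrMaxPositions.1 (List.getElem_mem hi)
  have hmaps : ∀ j ∈ Finset.Icc 1 (L[i + 1] - 1), π j ∈ Finset.Icc 1 (π L[i]) := by
    intro j hj
    rw [Finset.mem_Icc] at hj ⊢
    refine ⟨(hπ.1.mapsTo (show j ∈ Set.Icc 1 n from ⟨hj.1, by omega⟩)).1, ?_⟩
    obtain ⟨k, hk, hkj, hmax, hle⟩ := exists_isLRMax_le π j hj.1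
    have hkL : k ∈ L := mem_lrMaxPositions.2 ⟨⟨hk, by omega⟩, hmax⟩
    refine hle.trans ?_
    have hk' : Nat.count (· ∈ L) k < i + 1 := by
      rw [← count_mem_getElem (l := L) pairwise_lrMaxPositions hi]
      exact Nat.count_strict_mono hkL (by omega)
    have hki : k ≤ L[i] := by
      by_contra hlt
      push Not at hlt
      have := (getElem_lt_iff_lt_count (l := L) pairwise_lrMaxPositions (by omega) k).1 hlt
      omega
    rcases hki.eq_or_lt with h | h
    · rw [h]
    · exact ((mem_lrMaxPositions.1 (List.getElem_mem (l := L) (by omega))).2 k hk h).le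
  have hcard := Finset.card_le_card_of_injOn π hmaps fun a ha b hb hab => by
    simp only [Finset.coe_Icc, Set.mem_Icc] at ha hb
    exact hπ.1.injOn ⟨ha.1, by omega⟩ ⟨hb.1, by omega⟩ hab
  simpa using hcard

theorem validCode_lrMaxCode (hπ : PermOn n π) :
    ValidCode n (lrMaxCode n π).1 (lrMaxCode n π).2 := by
  rcases Nat.eq_zero_or_pos n with rfl | hn
  · exact ⟨rfl, le_rfl, List.IsChain.nil, List.IsChain.nil,
      by simp [lrMaxCode, lrMaxPositions]⟩
  have hlen : (lrMaxPositions n π).length ≤ n :=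
    (List.length_filter_le _ _).trans (by simp)
  have hA := pairwise_map_lrMaxPositions (n := n) (π := π)
  have hD := pairwise_lrMaxPositions (n := n) (π := π)
  have hmemD : ∀ x ∈ (lrMaxCode n π).2, x + 1 ∈ lrMaxPositions n π := fun x hx => by
    rw [← one_cons_map_snd_lrMaxCode hn]
    exact List.mem_cons_of_mem _ (List.mem_map.2 ⟨x, hx, rfl⟩)
  rw [← fst_lrMaxCode_append hn hπ, List.pairwise_append] at hA
  rw [← one_cons_map_snd_lrMaxCode hn, List.pairwise_cons, List.pairwise_map] at hD
  refine ⟨by simp [lrMaxCode], by simp [lrMaxCode]; omega, List.isChain_iff_pairwise.2 hA.1,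
    List.isChain_iff_pairwise.2 (hD.2.imp (by omega)), fun x hx => ⟨?_, ?_⟩,
    fun x hx => ⟨?_, ?_⟩, ?_⟩
  · obtain ⟨i, hi, rfl⟩ := List.mem_map.1 (List.mem_of_mem_dropLast hx)
    exact (hπ.1.mapsTo (mem_lrMaxPositions.1 hi).1).1
  · have := hA.2.2 x hx n (List.mem_singleton_self _)
    omega
  · have := hD.1 (x + 1) (List.mem_map.2 ⟨x, hx, rfl⟩)
    omega
  · have := (mem_lrMaxPositions.1 (hmemD x hx)).1.2
    omega
  · intro i hi
    have hi' : i + 1 < (lrMaxPositions n π).length := by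
      simp [lrMaxCode] at hi
      omega
    have := getElem_succ_lrMaxPositions_le hπ hi'
    rw [List.getD_eq_getElem _ _ hi, List.getD_eq_getElem _ _ (by simp [lrMaxCode]; omega)]
    simpa [lrMaxCode, Nat.add_comm] using this

theorem lt_of_not_isLRMax (hπ : PermOn n π) (hav : Av321 n π) {i j : ℕ} (hi : 1 ≤ i)
    (hij : i < j) (hj : j ≤ n) (hmax : ¬ IsLRMax π i) : π i < π j := by
  simp only [IsLRMax] at hmax
  push Not at hmax
  obtain ⟨k, hk, hki, hle⟩ := hmax
  have hne : π i ≠ π k := fun h => by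
    have := hπ.1.injOn ⟨hi, by omega⟩ ⟨hk, by omega⟩ h
    omega
  have hne' : π i ≠ π j := fun h => by
    have := hπ.1.injOn ⟨hi, by omega⟩ ⟨by omega, hj⟩ h
    omega
  have := hav k i j hk hki hij hj
  omega

theorem le_of_eqOn_lrMaxPositions (hπ : PermOn n π) (hσ : PermOn n σ) (hav : Av321 n σ)
    (hpos : lrMaxPositions n π = lrMaxPositions n σ)
    (hval : ∀ i ∈ lrMaxPositions n π, π i = σ i) {i : ℕ} (hi : i ∈ Set.Icc 1 n)
    (ih : ∀ j < i, π j = σ j) : σ i ≤ π i := by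
  by_contra hlt
  push Not at hlt
  have hiL : i ∉ lrMaxPositions n σ := fun h => by
    have := hval i (hpos ▸ h)
    omega
  obtain ⟨j, hj, hji⟩ := hσ.1.surjOn (hπ.1.mapsTo hi)
  have hne : π j ≠ σ j := fun h => by
    have := hπ.1.injOn hj hi (h.trans hji)
    subst this
    omega
  rcases lt_trichotomy j i with h | rfl | h
  · exact hne (ih j h)
  · omega
  · have := lt_of_not_isLRMax hσ hav hi.1 h hj.2 fun hm => hiL (mem_lrMaxPositions.2 ⟨hi, hm⟩)
    omega

theorem injOn_lrMaxCode (n : ℕ) :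
    Set.InjOn (lrMaxCode n) {π : ℕ → ℕ | PermOn n π ∧ Av321 n π} := by
  rintro π ⟨hπ, havπ⟩ σ ⟨hσ, havσ⟩ hcode
  have hout : ∀ i, i ∉ Set.Icc 1 n → π i = σ i := fun i hi => (hπ.2 i hi).trans (hσ.2 i hi).symm
  rcases Nat.eq_zero_or_pos n with rfl | hn
  · funext i
    exact hout i fun h => by
      have := h.1.trans h.2
      omega
  have hpos : lrMaxPositions n π = lrMaxPositions n σ := by
    rw [← one_cons_map_snd_lrMaxCode hn, ← one_cons_map_snd_lrMaxCode hn, hcode]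
  have hval : ∀ i ∈ lrMaxPositions n π, π i = σ i := by
    refine List.map_inj_left.1 ?_
    rw [← fst_lrMaxCode_append hn hπ, hcode, fst_lrMaxCode_append hn hσ, hpos]
  funext i
  induction i using Nat.strong_induction_on with
  | _ i ih =>
    by_cases hi : i ∈ Set.Icc 1 n
    · exact le_antisymm
        (le_of_eqOn_lrMaxPositions hσ hπ havπ hpos.symm
          (fun j hj => (hval j (hpos ▸ hj)).symm) hi fun j hj => (ih j hj).symm)
        (le_of_eqOn_lrMaxPositions hπ hσ havσ hpos hval hi ih)
    · exact hout i hi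

end LeftToRightMaxima

section Reconstruction

/-- The map sending the elements of the sorted list `P` to those of `M` in order, and the
complement of `P` increasingly onto the complement of `M`. -/
noncomputable def interleave (P M : List ℕ) (i : ℕ) : ℕ :=
  if i ∈ P then M.getD (Nat.count (· ∈ P) i) 0 else Nat.nth (· ∉ M) (Nat.count (· ∉ P) i)

variable {P M : List ℕ}

theorem interleave_getElem (hP : P.Pairwise (· < ·)) (hlen : P.length = M.length) {j : ℕ}
    (hj : j < P.length) : interleave P M P[j] = M[j] := by
  rw [interleave, if_pos (List.getElem_mem hj), count_mem_getElem hP hj, List.getD_eq_getElem]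

theorem map_interleave (hP : P.Pairwise (· < ·)) (hlen : P.length = M.length) :
    P.map (interleave P M) = M :=
  List.ext_getElem (by simpa using hlen) fun j hj _ => by
    rw [List.getElem_map, interleave_getElem hP hlen]

theorem interleave_lt_of_mem (hP : P.Pairwise (· < ·)) (hM : M.Pairwise (· < ·))
    (hlen : P.length = M.length) {i j : ℕ} (hi : i ∈ P) (hj : j ∈ P) (hij : i < j) :
    interleave P M i < interleave P M j := by
  obtain ⟨a, ha, rfl⟩ := List.mem_iff_getElem.1 hi
  obtain ⟨b, hb, rfl⟩ := List.mem_iff_getElem.1 hj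
  rw [interleave_getElem hP hlen, interleave_getElem hP hlen]
  refine List.pairwise_iff_getElem.1 hM a b _ _ ?_
  rwa [getElem_lt_iff_lt_count hP, count_mem_getElem hP] at hij

theorem interleave_lt_of_notMem {i j : ℕ} (hi : i ∉ P) (hj : j ∉ P) (hij : i < j) :
    interleave P M i < interleave P M j := by
  rw [interleave, interleave, if_neg hi, if_neg hj]
  exact Nat.nth_strictMono (infinite_ofPred_notMem M)
    (Nat.count_strict_mono (p := (· ∉ P)) hi hij)

theorem interleave_mem_iff (hP : P.Pairwise (· < ·)) (hlen : P.length = M.length) {i : ℕ} :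
    interleave P M i ∈ M ↔ i ∈ P := by
  constructor
  · intro h
    by_contra hi
    rw [interleave, if_neg hi] at h
    exact Nat.nth_mem_of_infinite (infinite_ofPred_notMem M) _ h
  · intro h
    have := List.mem_map_of_mem (f := interleave P M) h
    rwa [map_interleave hP hlen] at this

theorem interleave_injective (hP : P.Pairwise (· < ·)) (hM : M.Pairwise (· < ·))
    (hlen : P.length = M.length) : Function.Injective (interleave P M) := by
  refine Function.Injective.of_lt_imp_ne fun i j hij heq => ?_
  by_cases hi : i ∈ P
  · have hj : j ∈ P := by rwa [← interleave_mem_iff hP hlen, ← heq, interleave_mem_iff hP hlen]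
    exact (interleave_lt_of_mem hP hM hlen hi hj hij).ne heq
  · have hj : j ∉ P := by rwa [← interleave_mem_iff hP hlen, ← heq, interleave_mem_iff hP hlen]
    exact (interleave_lt_of_notMem hi hj hij).ne heq

theorem interleave_eq_self (hlen : P.length = M.length) (hP : P.Pairwise (· < ·))
    (hM : M.Pairwise (· < ·)) {n i : ℕ} (hPn : ∀ x ∈ P, x ∈ Set.Icc 1 n)
    (hMn : ∀ x ∈ M, x ∈ Set.Icc 1 n) (hi : i ∉ Set.Icc 1 n) : interleave P M i = i := by
  have hcount : Nat.count (· ∈ P) i = Nat.count (· ∈ M) i := by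
    rcases Nat.eq_zero_or_pos i with rfl | hpos
    · simp
    · have hni : n < i := by
        simp only [Set.mem_Icc, not_and, not_le] at hi
        exact hi hpos
      rw [count_mem_eq_length hP fun x hx => (hPn x hx).2.trans_lt hni,
        count_mem_eq_length hM fun x hx => (hMn x hx).2.trans_lt hni, hlen]
  have hP' := count_notMem_add_count_mem P i
  have hM' := count_notMem_add_count_mem M i
  rw [interleave, if_neg fun h => hi (hPn i h),
    show Nat.count (· ∉ P) i = Nat.count (· ∉ M) i by omega]
  exact Nat.nth_count (p := (· ∉ M)) fun h => hi (hMn i h)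

theorem permOn_interleave (hlen : P.length = M.length) (hP : P.Pairwise (· < ·))
    (hM : M.Pairwise (· < ·)) {n : ℕ} (hPn : ∀ x ∈ P, x ∈ Set.Icc 1 n)
    (hMn : ∀ x ∈ M, x ∈ Set.Icc 1 n) : PermOn n (interleave P M) := by
  have hinj := interleave_injective hP hM hlen
  have hout : ∀ i, i ∉ Set.Icc 1 n → interleave P M i = i := fun i hi =>
    interleave_eq_self hlen hP hM hPn hMn hi
  have hmaps : Set.MapsTo (interleave P M) (Set.Icc 1 n) (Set.Icc 1 n) := fun i hi => by
    by_contra h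
    exact h ((hinj (hout _ h)).symm ▸ hi)
  refine ⟨⟨hmaps, hinj.injOn, ?_⟩, hout⟩
  have := Finset.surjOn_of_injOn_of_card_le (s := Finset.Icc 1 n) (t := Finset.Icc 1 n)
    (interleave P M) (by simpa using hmaps) hinj.injOn le_rfl
  simpa using this

/-- If `P` starts with `1`, `M` ends with `n`, and `P[c] ≤ M[c - 1] + 1` for all `c`, then every
position outside `P` has a larger value of `interleave P M` at some earlier position in `P`. -/
theorem exists_mem_interleave_lt (hlen : P.length = M.length) (hP : P.Pairwise (· < ·))
    (hM : M.Pairwise (· < ·)) {n i : ℕ} (hone : 1 ∈ P) (hlast : M.getLast? = some n)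
    (hPM : ∀ c (hc : c + 1 < P.length), P[c + 1] ≤ M[c] + 1)
    (hi : i ∈ Set.Icc 1 n) (hiP : i ∉ P) :
    ∃ p ∈ P, p < i ∧ interleave P M i < interleave P M p := by
  have hi1 : 1 < i := lt_of_le_of_ne hi.1 fun h => hiP (h ▸ hone)
  obtain ⟨c, hc⟩ : ∃ c, Nat.count (· ∈ P) i = c + 1 :=
    Nat.exists_eq_succ_of_ne_zero ((Nat.count_strict_mono (p := (· ∈ P)) hone hi1).ne_bot)
  have hcP : c < P.length := by
    have := count_mem_le_length P i
    omega
  have hcM : c < M.length := hlen ▸ hcP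
  have hle : i ≤ M[c] := by
    rcases Nat.lt_or_ge (c + 1) P.length with h | h
    · have := hPM c h
      have hlt : ¬ P[c + 1] < i := by
        rw [getElem_lt_iff_lt_count hP]
        omega
      have hne : P[c + 1] ≠ i := fun h' => hiP (h' ▸ List.getElem_mem h)
      omega
    · have hMc : M[c] = n := by
        rw [List.getLast?_eq_getElem?, show M.length - 1 = c by omega,
          List.getElem?_eq_getElem hcM] at hlast
        simpa using hlast
      exact hMc ▸ hi.2
  refine ⟨P[c], List.getElem_mem hcP, (getElem_lt_iff_lt_count hP hcP i).2 (by omega), ?_⟩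
  rw [interleave_getElem hP hlen, interleave, if_neg hiP]
  refine Nat.nth_lt_of_lt_count ?_
  have h₁ := count_notMem_add_count_mem P i
  have h₂ := count_notMem_add_count_mem M M[c]
  rw [count_mem_getElem hM hcM] at h₂
  omega

theorem isLRMax_iff_mem_of_dominated {n : ℕ} {π : ℕ → ℕ} (hPn : ∀ x ∈ P, x ∈ Set.Icc 1 n)
    (hmono : ∀ i ∈ P, ∀ j ∈ P, i < j → π i < π j)
    (hdom : ∀ i ∈ Set.Icc 1 n, i ∉ P → ∃ p ∈ P, p < i ∧ π i < π p) {i : ℕ}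
    (hi : i ∈ Set.Icc 1 n) : IsLRMax π i ↔ i ∈ P := by
  constructor
  · intro h
    by_contra hiP
    obtain ⟨p, hp, hpi, hlt⟩ := hdom i hi hiP
    exact lt_asymm hlt (h p (hPn p hp).1 hpi)
  · intro hiP j hj hji
    by_cases hjP : j ∈ P
    · exact hmono j hjP i hiP hji
    · obtain ⟨p, hp, hpj, hlt⟩ := hdom j ⟨hj, hji.le.trans hi.2⟩ hjP
      exact hlt.trans (hmono p hp i hiP (hpj.trans hji))

theorem surjOn_lrMaxCode (n : ℕ) :
    Set.SurjOn (lrMaxCode n) {π : ℕ → ℕ | PermOn n π ∧ Av321 n π}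
      {c : List ℕ × List ℕ | ValidCode n c.1 c.2} := by
  rintro ⟨A, D⟩ ⟨hlen, hr, hA, hD, hAn, hDn, hAD⟩
  simp only at hlen hr hA hD hAn hDn hAD
  rcases Nat.eq_zero_or_pos n with rfl | hn
  · refine ⟨id, ⟨⟨by simp, fun _ _ => rfl⟩, fun i j k => by omega⟩, ?_⟩
    have hA0 : A = [] := List.length_eq_zero_iff.1 (by omega)
    have hD0 : D = [] := List.length_eq_zero_iff.1 (by omega)
    simp [lrMaxCode, lrMaxPositions, hA0, hD0]
  set P := 1 :: D.map (· + 1) with hPdef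
  set M := A ++ [n] with hMdef
  have hPM : P.length = M.length := by simp [hPdef, hMdef, hlen]
  have hP : P.Pairwise (· < ·) := by
    rw [hPdef, List.pairwise_cons, List.pairwise_map]
    refine ⟨fun x hx => ?_, (List.isChain_iff_pairwise.1 hD).imp (by omega)⟩
    obtain ⟨d, hd, rfl⟩ := List.mem_map.1 hx
    have := hDn d hd
    omega
  have hM : M.Pairwise (· < ·) := by
    rw [hMdef, List.pairwise_append]
    refine ⟨List.isChain_iff_pairwise.1 hA, List.pairwise_singleton _ _, fun x hx y hy => ?_⟩
    have := hAn x hx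
    rw [List.mem_singleton.1 hy]
    omega
  have hPn : ∀ x ∈ P, x ∈ Set.Icc 1 n := by
    intro x hx
    rcases List.mem_cons.1 hx with rfl | hx
    · exact ⟨le_rfl, hn⟩
    · obtain ⟨d, hd, rfl⟩ := List.mem_map.1 hx
      have := hDn d hd
      exact ⟨by omega, by omega⟩
  have hMn : ∀ x ∈ M, x ∈ Set.Icc 1 n := by
    intro x hx
    rcases List.mem_append.1 hx with hx | hx
    · have := hAn x hx
      exact ⟨by omega, by omega⟩
    · rw [List.mem_singleton.1 hx]
      exact ⟨hn, le_rfl⟩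
  have hstep : ∀ c (hc : c + 1 < P.length), P[c + 1] ≤ M[c] + 1 := by
    intro c hc
    have hcD : c < D.length := by simpa [hPdef] using hc
    have hcA : c < A.length := hlen ▸ hcD
    have := hAD c hcA
    rw [List.getD_eq_getElem _ _ hcA, List.getD_eq_getElem _ _ hcD] at this
    simpa [hPdef, hMdef, List.getElem_append_left hcA] using this
  have hmax : ∀ i ∈ Set.Icc 1 n, (IsLRMax (interleave P M) i ↔ i ∈ P) := fun i hi =>
    isLRMax_iff_mem_of_dominated hPn
      (fun a ha b hb hab => interleave_lt_of_mem hP hM hPM ha hb hab)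
      (fun a ha haP => exists_mem_interleave_lt hPM hP hM (by simp [hPdef]) (by simp [hMdef])
        hstep ha haP) hi
  have hpos : lrMaxPositions n (interleave P M) = P := by
    refine eq_of_pairwise_lt_of_mem_iff pairwise_lrMaxPositions hP fun x => ?_
    rw [mem_lrMaxPositions]
    exact ⟨fun h => (hmax x h.1).1 h.2, fun h => ⟨hPn x h, (hmax x (hPn x h)).2 h⟩⟩
  refine ⟨interleave P M, ⟨permOn_interleave hPM hP hM hPn hMn, ?_⟩, ?_⟩
  · rintro i j k hi hij hjk hk ⟨hkj, hji⟩
    have hj : j ∉ P := fun h =>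
      lt_asymm hji ((hmax j ⟨by omega, by omega⟩).2 h i hi hij)
    have hk : k ∉ P := fun h =>
      lt_asymm hkj ((hmax k ⟨by omega, by omega⟩).2 h j (by omega) hjk)
    exact lt_asymm hkj (interleave_lt_of_notMem hj hk hjk)
  · rw [lrMaxCode, hpos, map_interleave hP hPM]
    simp [hPdef, hMdef, Function.comp_def]

end Reconstruction

/-- The LRMax code is a bijection from 321-avoiding permutations of `{1, …, n}` onto the
pairs of integer sequences `(A, D)` satisfying `0 ≤ r ≤ n - 1`,
`1 ≤ A_1 < … < A_r ≤ n - 1`, `1 ≤ D_1 < … < D_r ≤ n - 1`, and `A_i ≥ D_i` for all `i`. -/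
theorem lrMaxCode_bijOn (n : ℕ) :
    Set.BijOn (lrMaxCode n) {π : ℕ → ℕ | PermOn n π ∧ Av321 n π}
      {c : List ℕ × List ℕ | ValidCode n c.1 c.2} := by
  exact ⟨fun _ h => validCode_lrMaxCode h.1, injOn_lrMaxCode n, surjOn_lrMaxCode n⟩
end

section
/- The excedance code is a bijection from the set of 321-avoiding permutations of {1,...,n} onto the set of pairs of integer sequences ((A_i)_{i=1}^r,(D_i)_{i=1}^r) satisfying: 0 ≤ r ≤ n-1, 1 ≤ A_1 < ... < A_r ≤ n-1, 1 ≤ D_1 < ... < D_r ≤ n-1, and A_i ≥ D_i for all 1 ≤ i ≤ r. -/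
/-- The excedance code `(A, D)` of a permutation of `{1, …, n}` with excedance locations
`ℓ_1 < … < ℓ_r` and excedance values `v_i = π ℓ_i`: `A_i = v_i - 1` and `D_i = ℓ_i`. -/
def excCode (n : ℕ) (π : ℕ → ℕ) : List ℕ × List ℕ :=
  (((List.range' 1 n).filter (fun i => decide (i < π i))).map (fun i => π i - 1),
   (List.range' 1 n).filter (fun i => decide (i < π i)))

section Avoidance

variable {n : ℕ} {π : ℕ → ℕ}

/-- In a permutation, a weak excedance `j` lying below an earlier value also lies above
some later value. -/
theorem PermOn.exists_gt_lt_of_weak_excedance (hπ : PermOn n π) {i j : ℕ} (hi : 1 ≤ i)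
    (hij : i < j) (hjn : j ≤ n) (hj : j ≤ π j) (h : π j < π i) :
    ∃ k, j < k ∧ k ≤ n ∧ π k < π j := by
  by_contra! hk
  have hπj := hπ.1.mapsTo (Set.mem_Icc.2 ⟨by omega, hjn⟩)
  rw [Set.mem_Icc] at hπj
  have hsub : Finset.Icc 1 (π j - 1) ⊆ ((Finset.Icc 1 (j - 1)).erase i).image π := by
    intro v hv
    rw [Finset.mem_Icc] at hv
    obtain ⟨k, hk1, rfl⟩ := hπ.1.surjOn (Set.mem_Icc.2 ⟨hv.1, by omega⟩)
    rw [Set.mem_Icc] at hk1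
    have hkj : k < j := by
      rcases lt_trichotomy k j with h1 | rfl | h1
      · exact h1
      · omega
      · have := hk k h1 hk1.2
        omega
    refine Finset.mem_image_of_mem _ (Finset.mem_erase.2 ⟨?_, Finset.mem_Icc.2 ⟨hk1.1, by omega⟩⟩)
    rintro rfl
    omega
  have hcard := (Finset.card_le_card hsub).trans Finset.card_image_le
  rw [Finset.card_erase_of_mem (Finset.mem_Icc.2 ⟨hi, by omega⟩)] at hcard
  simp only [Nat.card_Icc] at hcard
  omega

/-- In a permutation, a non-excedance `i` lying above a later value also lies below
some earlier value. -/
theorem PermOn.exists_lt_gt_of_le (hπ : PermOn n π) {i j : ℕ} (hi : 1 ≤ i)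
    (hij : i < j) (hjn : j ≤ n) (hle : π i ≤ i) (h : π j < π i) :
    ∃ k, 1 ≤ k ∧ k < i ∧ π i < π k := by
  by_contra! hk
  have hπj := hπ.1.mapsTo (Set.mem_Icc.2 ⟨by omega, hjn⟩)
  rw [Set.mem_Icc] at hπj
  have hmaps : Set.MapsTo π (Finset.Icc 1 (i - 1)) ((Finset.Icc 1 (π i - 1)).erase (π j)) := by
    intro k hk1
    rw [Finset.mem_coe, Finset.mem_Icc] at hk1
    have hkn : k ∈ Set.Icc 1 n := ⟨hk1.1, by omega⟩
    have hne {m : ℕ} (hm : m ∈ Set.Icc 1 n) (hkm : k ≠ m) : π k ≠ π m :=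
      fun he => hkm (hπ.1.injOn hkn hm he)
    have h1 := hne (m := i) ⟨hi, by omega⟩ (by omega)
    have h2 := hne (m := j) ⟨by omega, hjn⟩ (by omega)
    have h3 := hk k hk1.1 (by omega)
    have h4 := (hπ.1.mapsTo hkn).1
    exact Finset.mem_erase.2 ⟨h2, Finset.mem_Icc.2 ⟨h4, by omega⟩⟩
  have hinj : Set.InjOn π (Finset.Icc 1 (i - 1)) := by
    refine hπ.1.injOn.mono fun k hk1 => ?_
    rw [Finset.mem_coe, Finset.mem_Icc] at hk1
    exact ⟨hk1.1, by omega⟩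
  have hcard := Finset.card_le_card_of_injOn π hmaps hinj
  rw [Finset.card_erase_of_mem (Finset.mem_Icc.2 ⟨hπj.1, by omega⟩)] at hcard
  simp only [Nat.card_Icc] at hcard
  omega

/-- The excedance values of a 321-avoiding permutation increase. -/
theorem Av321.lt_of_excedance (hav : Av321 n π) (hπ : PermOn n π) {i j : ℕ} (hi : 1 ≤ i)
    (hij : i < j) (hjn : j ≤ n) (hj : j ≤ π j) : π i < π j := by
  by_contra! h
  have hne : π j ≠ π i := fun he =>
    hij.ne' (hπ.1.injOn ⟨by omega, hjn⟩ ⟨hi, by omega⟩ he)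
  obtain ⟨k, hjk, hkn, hk⟩ := hπ.exists_gt_lt_of_weak_excedance hi hij hjn hj (by omega)
  exact hav i j k hi hij hjk hkn ⟨hk, by omega⟩

/-- The non-excedance values of a 321-avoiding permutation increase. -/
theorem Av321.lt_of_not_excedance (hav : Av321 n π) (hπ : PermOn n π) {i j : ℕ} (hi : 1 ≤ i)
    (hij : i < j) (hjn : j ≤ n) (hle : π i ≤ i) : π i < π j := by
  by_contra! h
  have hne : π j ≠ π i := fun he =>
    hij.ne' (hπ.1.injOn ⟨by omega, hjn⟩ ⟨hi, by omega⟩ he)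
  obtain ⟨k, hk1, hki, hk⟩ := hπ.exists_lt_gt_of_le hi hij hjn hle (by omega)
  exact hav k i j hk1 hki hij hjn ⟨by omega, hk⟩

theorem mem_excCode_snd {i : ℕ} : i ∈ (excCode n π).2 ↔ (1 ≤ i ∧ i ≤ n) ∧ i < π i := by
  simp only [excCode, List.mem_filter, List.mem_range'_1, decide_eq_true_eq]
  omega

theorem pairwise_excCode_snd : (excCode n π).2.Pairwise (· < ·) :=
  List.Pairwise.filter _ List.pairwise_lt_range'

theorem excCode_fst : (excCode n π).1 = (excCode n π).2.map (fun i => π i - 1) := rfl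

/-- The excedance code of a 321-avoiding permutation is valid. -/
theorem validCode_excCode (hπ : PermOn n π) (hav : Av321 n π) :
    ValidCode n (excCode n π).1 (excCode n π).2 := by
  have hbound {i : ℕ} (hi : i ∈ (excCode n π).2) : 1 ≤ i ∧ i < π i ∧ π i ≤ n := by
    rw [mem_excCode_snd] at hi
    exact ⟨hi.1.1, hi.2, (hπ.1.mapsTo (Set.mem_Icc.2 hi.1)).2⟩
  have hlen : (excCode n π).2.length ≤ n - 1 := by
    rw [← List.toFinset_card_of_nodup (pairwise_excCode_snd.imp ne_of_lt)]
    have hsub : (excCode n π).2.toFinset ⊆ Finset.Icc 1 (n - 1) := by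
      intro i hi
      have := hbound (List.mem_toFinset.1 hi)
      exact Finset.mem_Icc.2 (by omega)
    simpa using Finset.card_le_card hsub
  refine ⟨by simp [excCode_fst], by simpa [excCode_fst] using hlen, ?_, ?_, ?_, ?_, ?_⟩
  · refine List.isChain_iff_pairwise.2 ?_
    rw [excCode_fst, List.pairwise_map]
    refine pairwise_excCode_snd.imp_of_mem fun {i j} hi hj hij => ?_
    have h1 := hbound hi
    have h2 := hbound hj
    have := hav.lt_of_excedance hπ h1.1 hij (by omega) (by omega)
    omega
  · exact List.isChain_iff_pairwise.2 pairwise_excCode_snd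
  · intro x hx
    rw [excCode_fst, List.mem_map] at hx
    obtain ⟨i, hi, rfl⟩ := hx
    have := hbound hi
    omega
  · intro i hi
    have := hbound hi
    omega
  · intro k hk
    have hk' : k < (excCode n π).2.length := by simpa [excCode_fst] using hk
    rw [List.getD_eq_getElem _ _ hk, List.getD_eq_getElem _ _ hk']
    simp only [excCode_fst, List.getElem_map]
    have := hbound (List.getElem_mem hk')
    omega

/-- If two 321-avoiding permutations have the same code and agree before `i`, then the value of
the second at `i` does not exceed that of the first. -/
theorem le_of_excCode_eq {σ : ℕ → ℕ} (hπ : PermOn n π) (hσ : PermOn n σ) (hσav : Av321 n σ)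
    (hexc : ∀ i ∈ Set.Icc 1 n, (i < π i ↔ i < σ i) ∧ (i < π i → π i = σ i))
    {i : ℕ} (hi : i ∈ Set.Icc 1 n) (hlt : ∀ j ∈ Set.Icc 1 n, j < i → π j = σ j) :
    σ i ≤ π i := by
  by_contra! h
  obtain ⟨j, hj, hji⟩ := hσ.1.surjOn (hπ.1.mapsTo hi)
  rcases lt_trichotomy j i with hlt' | rfl | hgt
  · rw [← hlt j hj hlt'] at hji
    exact hlt'.ne (hπ.1.injOn hj hi hji)
  · omega
  · have hnot : ¬ i < σ i := fun hc => by
      have := (hexc i hi).2 ((hexc i hi).1.2 hc)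
      omega
    have := hσav.lt_of_not_excedance hσ hi.1 hgt hj.2 (by omega)
    omega

theorem excCode_injOn : Set.InjOn (excCode n) {π : ℕ → ℕ | PermOn n π ∧ Av321 n π} := by
  rintro π ⟨hπ, hπav⟩ σ ⟨hσ, hσav⟩ heq
  have hsnd : (excCode n π).2 = (excCode n σ).2 := congrArg Prod.snd heq
  have hfst : (excCode n π).1 = (excCode n σ).1 := congrArg Prod.fst heq
  have hexc : ∀ i ∈ Set.Icc 1 n, (i < π i ↔ i < σ i) ∧ (i < π i → π i = σ i) := by
    intro i hi
    have hiff : i < π i ↔ i < σ i := by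
      have h1 := mem_excCode_snd (n := n) (π := π) (i := i)
      have h2 := mem_excCode_snd (n := n) (π := σ) (i := i)
      rw [hsnd, h2] at h1
      have := Set.mem_Icc.1 hi
      tauto
    refine ⟨hiff, fun h => ?_⟩
    rw [excCode_fst, excCode_fst, hsnd, List.map_inj_left] at hfst
    have := hfst i (mem_excCode_snd.2 ⟨hi, hiff.1 h⟩)
    have := hiff.1 h
    omega
  have hexc' : ∀ i ∈ Set.Icc 1 n, (i < σ i ↔ i < π i) ∧ (i < σ i → σ i = π i) :=
    fun i hi => ⟨(hexc i hi).1.symm, fun h => ((hexc i hi).2 ((hexc i hi).1.2 h)).symm⟩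
  funext i
  by_cases hi : i ∈ Set.Icc 1 n
  · induction i using Nat.strong_induction_on with
    | _ i ih =>
      exact le_antisymm
        (le_of_excCode_eq hσ hπ hπav hexc' hi fun j hj hji => (ih j hji hj).symm)
        (le_of_excCode_eq hπ hσ hσav hexc hi fun j hj hji => ih j hji hj)
  · rw [hπ.2 i hi, hσ.2 i hi]

end Avoidance

section Counting

/-- The indices smaller than `i` split into those satisfying `p` and those not. -/
theorem Nat.count_not_add_count (p : ℕ → Prop) [DecidablePred p] (i : ℕ) :
    Nat.count (fun x => ¬ p x) i + Nat.count p i = i := by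
  induction i with
  | zero => simp
  | succ i ih =>
    rw [Nat.count_succ, Nat.count_succ]
    split_ifs <;> omega

theorem Finset.toFinset_ofPred_mem (V : Finset ℕ) (hf : (Set.ofPred (· ∈ V)).Finite) :
    hf.toFinset = V := by
  ext x
  simp

theorem Finset.lt_card_toFinset_ofPred {V : Finset ℕ} {k : ℕ} (hk : k < V.card)
    (hf : (Set.ofPred (· ∈ V)).Finite) : k < hf.toFinset.card := by
  rwa [V.toFinset_ofPred_mem hf]

theorem Finset.infinite_ofPred_notMem (V : Finset ℕ) : (Set.ofPred (· ∉ V)).Infinite :=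
  V.finite_toSet.infinite_compl

theorem Finset.count_lt_card_of_mem {D : Finset ℕ} {i : ℕ} (hi : i ∈ D) :
    Nat.count (· ∈ D) i < D.card := by
  have hf : (Set.ofPred (· ∈ D)).Finite := D.finite_toSet
  have h := Nat.count_lt_card (p := (· ∈ D)) hf hi
  rwa [D.toFinset_ofPred_mem hf] at h

theorem Finset.count_eq_card_of_forall_lt {D : Finset ℕ} {i : ℕ} (h : ∀ x ∈ D, x < i) :
    Nat.count (· ∈ D) i = D.card := by
  rw [Nat.count_eq_card_filter_range]
  congr 1
  ext x
  simpa using h x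

/-- The `k`-th element of a strictly increasing list is its `k`-th entry. -/
theorem List.nth_mem_toFinset {l : List ℕ} (hl : l.Pairwise (· < ·)) (k : ℕ) :
    Nat.nth (· ∈ l.toFinset) k = l.getD k 0 := by
  have hf : (Set.ofPred (· ∈ l.toFinset)).Finite := l.toFinset.finite_toSet
  rw [Nat.nth_eq_getD_sort hf, Finset.toFinset_ofPred_mem, (List.toFinset_sort (r := (· ≤ ·)) (hl.imp ne_of_lt)).2
    (hl.imp le_of_lt)]

end Counting

section Construction

/-- The map sending `D` increasingly onto `V` and the complement of `D` increasingly onto the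
complement of `V`. -/
noncomputable def shuffleMap (D V : Finset ℕ) (i : ℕ) : ℕ :=
  if i ∈ D then Nat.nth (· ∈ V) (Nat.count (· ∈ D) i)
  else Nat.nth (· ∉ V) (Nat.count (· ∉ D) i)

variable {D V : Finset ℕ} {i j n : ℕ}

theorem shuffleMap_of_mem (hi : i ∈ D) :
    shuffleMap D V i = Nat.nth (· ∈ V) (Nat.count (· ∈ D) i) := if_pos hi

theorem shuffleMap_of_notMem (hi : i ∉ D) :
    shuffleMap D V i = Nat.nth (· ∉ V) (Nat.count (· ∉ D) i) := if_neg hi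

theorem shuffleMap_mem_iff (hcard : D.card = V.card) : shuffleMap D V i ∈ V ↔ i ∈ D := by
  by_cases hi : i ∈ D
  · rw [shuffleMap_of_mem hi]
    exact iff_of_true (Nat.nth_mem (p := (· ∈ V)) _ (Finset.lt_card_toFinset_ofPred
      (hcard ▸ Finset.count_lt_card_of_mem hi))) hi
  · rw [shuffleMap_of_notMem hi]
    exact iff_of_false (Nat.nth_mem_of_infinite V.infinite_ofPred_notMem _) hi

/-- `shuffleMap` is increasing on `D` and on its complement. -/
theorem shuffleMap_lt (hcard : D.card = V.card) (hij : i < j) (hD : i ∈ D ↔ j ∈ D) :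
    shuffleMap D V i < shuffleMap D V j := by
  by_cases hj : j ∈ D
  · rw [shuffleMap_of_mem (hD.2 hj), shuffleMap_of_mem hj]
    exact Nat.nth_lt_nth' (Nat.count_strict_mono (hD.2 hj) hij)
      (Finset.lt_card_toFinset_ofPred (hcard ▸ Finset.count_lt_card_of_mem hj))
  · have hi : i ∉ D := fun h => hj (hD.1 h)
    rw [shuffleMap_of_notMem hi, shuffleMap_of_notMem hj]
    exact (Nat.nth_lt_nth V.infinite_ofPred_notMem).2
      (Nat.count_strict_mono (p := (· ∉ D)) hi hij)

theorem shuffleMap_injective (hcard : D.card = V.card) : Function.Injective (shuffleMap D V) := by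
  intro i j h
  have hD : i ∈ D ↔ j ∈ D := by
    rw [← shuffleMap_mem_iff hcard, h, shuffleMap_mem_iff hcard]
  rcases lt_trichotomy i j with hlt | heq | hgt
  · exact absurd h (shuffleMap_lt hcard hlt hD).ne
  · exact heq
  · exact absurd h (shuffleMap_lt hcard hgt hD.symm).ne'

theorem shuffleMap_eq_self (hcard : D.card = V.card) (hD : D ⊆ Finset.Icc 1 n)
    (hV : V ⊆ Finset.Icc 1 n) (hi : i ∉ Set.Icc 1 n) : shuffleMap D V i = i := by
  have hi' : i ∉ Finset.Icc 1 n := by simpa using hi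
  have hiD : i ∉ D := fun h => hi' (hD h)
  have hiV : i ∉ V := fun h => hi' (hV h)
  have hcount : Nat.count (· ∈ D) i = Nat.count (· ∈ V) i := by
    rcases Nat.eq_zero_or_pos i with rfl | hpos
    · simp
    · have hni : n < i := by
        by_contra! h
        exact hi ⟨hpos, h⟩
      rw [Finset.count_eq_card_of_forall_lt fun x hx => (Finset.mem_Icc.1 (hD hx)).2.trans_lt hni,
        Finset.count_eq_card_of_forall_lt fun x hx => (Finset.mem_Icc.1 (hV hx)).2.trans_lt hni,
        hcard]
  have h1 := Nat.count_not_add_count (· ∈ D) i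
  have h2 := Nat.count_not_add_count (· ∈ V) i
  rw [shuffleMap_of_notMem hiD,
    show Nat.count (· ∉ D) i = Nat.count (· ∉ V) i by omega]
  exact Nat.nth_count (p := (· ∉ V)) hiV

theorem permOn_shuffleMap (hcard : D.card = V.card) (hD : D ⊆ Finset.Icc 1 n)
    (hV : V ⊆ Finset.Icc 1 n) : PermOn n (shuffleMap D V) := by
  have hfix : ∀ i, i ∉ Set.Icc 1 n → shuffleMap D V i = i :=
    fun i hi => shuffleMap_eq_self hcard hD hV hi
  have hmaps : Set.MapsTo (shuffleMap D V) (Set.Icc 1 n) (Set.Icc 1 n) := by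
    intro i hi
    by_contra hc
    exact hc ((shuffleMap_injective hcard (hfix _ hc)).symm ▸ hi)
  have hinj : Set.InjOn (shuffleMap D V) (Set.Icc 1 n) := (shuffleMap_injective hcard).injOn
  refine ⟨⟨hmaps, hinj, ?_⟩, hfix⟩
  rw [← Finset.coe_Icc] at hmaps hinj ⊢
  exact Finset.surjOn_of_injOn_of_card_le _ hmaps hinj le_rfl

theorem av321_shuffleMap (hcard : D.card = V.card) : Av321 n (shuffleMap D V) := by
  rintro i j k - hij hjk - ⟨hkj, hji⟩
  have h1 := mt (shuffleMap_lt hcard hij) hji.not_gt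
  have h2 := mt (shuffleMap_lt hcard hjk) hkj.not_gt
  have h3 := mt (shuffleMap_lt hcard (hij.trans hjk)) (hkj.trans hji).not_gt
  tauto

/-- If `V` dominates `D` strictly, then the excedances of `shuffleMap D V` are exactly `D`. -/
theorem lt_shuffleMap_iff (hcard : D.card = V.card)
    (hdom : ∀ k < D.card, Nat.nth (· ∈ D) k < Nat.nth (· ∈ V) k) :
    i < shuffleMap D V i ↔ i ∈ D := by
  by_cases hi : i ∈ D
  · refine iff_of_true ?_ hi
    have h := hdom _ (Finset.count_lt_card_of_mem hi)
    rwa [Nat.nth_count (p := (· ∈ D)) hi, ← shuffleMap_of_mem hi] at h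
  · refine iff_of_false (not_lt.2 ?_) hi
    have hcount : Nat.count (· ∈ V) (i + 1) ≤ Nat.count (· ∈ D) i := by
      by_contra! h
      have hV : Nat.nth (· ∈ V) (Nat.count (· ∈ D) i) < i + 1 := Nat.nth_lt_of_lt_count h
      have hlt : Nat.count (· ∈ D) i < D.card := by
        have hle := Nat.count_le_card (p := (· ∈ V)) V.finite_toSet (i + 1)
        rw [V.toFinset_ofPred_mem] at hle
        omega
      have hlt' := hdom _ hlt
      have hDi : Nat.nth (· ∈ D) (Nat.count (· ∈ D) i) < i := by omega
      have hmem : Nat.nth (· ∈ D) (Nat.count (· ∈ D) i) ∈ D :=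
        Nat.nth_mem (p := (· ∈ D)) _ (Finset.lt_card_toFinset_ofPred hlt)
      have := Nat.count_strict_mono (p := (· ∈ D)) hmem hDi
      rw [Nat.count_nth (p := (· ∈ D)) (Finset.lt_card_toFinset_ofPred hlt)] at this
      omega
    have h1 := Nat.count_not_add_count (· ∈ D) i
    have h2 := Nat.count_not_add_count (· ∈ V) (i + 1)
    rw [shuffleMap_of_notMem hi]
    have hlt : Nat.nth (· ∉ V) (Nat.count (· ∉ D) i) < i + 1 := Nat.nth_lt_of_lt_count (by omega)
    omega

end Construction

theorem excCode_surjOn (n : ℕ) :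
    Set.SurjOn (excCode n) {π : ℕ → ℕ | PermOn n π ∧ Av321 n π}
      {c : List ℕ × List ℕ | ValidCode n c.1 c.2} := by
  rintro ⟨A, L⟩ ⟨hlen, -, hA, hL, hAb, hLb, hle⟩
  dsimp only at hlen hA hL hAb hLb hle
  replace hA : A.Pairwise (· < ·) := List.isChain_iff_pairwise.1 hA
  replace hL : L.Pairwise (· < ·) := List.isChain_iff_pairwise.1 hL
  have hA' : (A.map (· + 1)).Pairwise (· < ·) :=
    List.pairwise_map.2 (hA.imp fun h => Nat.succ_lt_succ h)
  set D := L.toFinset with hDdef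
  set V := (A.map (· + 1)).toFinset with hVdef
  have hDcard : D.card = L.length := List.toFinset_card_of_nodup (hL.imp ne_of_lt)
  have hcard : D.card = V.card := by
    rw [hDcard, hVdef, List.toFinset_card_of_nodup (hA'.imp ne_of_lt), List.length_map, hlen]
  have hD : D ⊆ Finset.Icc 1 n := by
    intro x hx
    have := hLb x (List.mem_toFinset.1 hx)
    exact Finset.mem_Icc.2 (by omega)
  have hV : V ⊆ Finset.Icc 1 n := by
    intro x hx
    obtain ⟨a, ha, rfl⟩ := List.mem_map.1 (List.mem_toFinset.1 hx)
    have := hAb a ha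
    exact Finset.mem_Icc.2 (by omega)
  have hVnth : ∀ k (hk : k < A.length), Nat.nth (· ∈ V) k = A[k] + 1 := by
    intro k hk
    rw [hVdef, List.nth_mem_toFinset hA', List.getD_eq_getElem _ _ (by simpa using hk),
      List.getElem_map]
  have hDnth : ∀ k (hk : k < L.length), Nat.nth (· ∈ D) k = L[k] := by
    intro k hk
    rw [hDdef, List.nth_mem_toFinset hL, List.getD_eq_getElem _ _ hk]
  have hdom : ∀ k < D.card, Nat.nth (· ∈ D) k < Nat.nth (· ∈ V) k := by
    intro k hk
    have hkL : k < L.length := hDcard ▸ hk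
    have hkA : k < A.length := hlen ▸ hkL
    have h := hle k hkA
    rw [List.getD_eq_getElem _ _ hkA, List.getD_eq_getElem _ _ hkL] at h
    rw [hVnth k hkA, hDnth k hkL]
    omega
  have hsnd : (excCode n (shuffleMap D V)).2 = L := by
    refine pairwise_excCode_snd.eq_of_mem_iff hL fun i => ?_
    rw [mem_excCode_snd, lt_shuffleMap_iff hcard hdom, hDdef, List.mem_toFinset]
    exact and_iff_right_of_imp fun hi => Finset.mem_Icc.1 (hD (List.mem_toFinset.2 hi))
  refine ⟨shuffleMap D V, ⟨permOn_shuffleMap hcard hD hV, av321_shuffleMap hcard⟩,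
    Prod.ext ?_ hsnd⟩
  rw [excCode_fst, hsnd]
  refine List.ext_getElem (by simp [hlen]) fun k hk hkA => ?_
  have hkL : k < L.length := by simpa using hk
  have hcount : Nat.count (· ∈ D) L[k] = k := by
    rw [← hDnth k hkL]
    exact Nat.count_nth (p := (· ∈ D)) (Finset.lt_card_toFinset_ofPred (hDcard ▸ hkL))
  rw [List.getElem_map, shuffleMap_of_mem (List.mem_toFinset.2 (List.getElem_mem hkL)), hcount,
    hVnth k hkA, Nat.add_sub_cancel]

/-- The excedance code is a bijection from 321-avoiding permutations of `{1, …, n}` onto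
the pairs of integer sequences `(A, D)` satisfying `0 ≤ r ≤ n - 1`,
`1 ≤ A_1 < … < A_r ≤ n - 1`, `1 ≤ D_1 < … < D_r ≤ n - 1`, and `A_i ≥ D_i` for all `i`. -/
theorem excCode_bijOn (n : ℕ) :
    Set.BijOn (excCode n) {π : ℕ → ℕ | PermOn n π ∧ Av321 n π}
      {c : List ℕ × List ℕ | ValidCode n c.1 c.2} :=
  ⟨fun _ h => validCode_excCode h.1 h.2, excCode_injOn, excCode_surjOn n⟩
end

section
/- Let π be a 321-avoiding permutation of {1,...,n} and let f_1 < f_2 < ... < f_q be its fixed points, splitting {1,...,n} into the concatenation I_0 f_1 I_1 f_2 ... f_q I_q of intervals I_0,...,I_q. Then π maps each interval I_j onto itself. -/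
/-- If an injective map sends a finite set `s` into itself, then points outside `s` are not
mapped into `s`. -/
lemma Set.InjOn.mem_of_apply_mem_of_mapsTo {α : Type*} {f : α → α} {s t : Set α}
    (hf : Set.InjOn f t) (hst : s ⊆ t) (hs : s.Finite) (hmaps : Set.MapsTo f s s) {x : α}
    (hx : x ∈ t) (hfx : f x ∈ s) : x ∈ s := by
  obtain ⟨y, hy, hyx⟩ :=
    ((hs.injOn_iff_bijOn_of_mapsTo hmaps).1 (hf.mono hst)).surjOn hfx
  exact hf (hst hy) hx hyx ▸ hy

/-- A 321-avoiding permutation maps no point to the left of a fixed point `c` to its right. -/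
lemma Av321.apply_lt_of_lt {n : ℕ} {π : ℕ → ℕ} (h : Av321 n π) (hπ : PermOn n π) {c i : ℕ}
    (hc : c ∈ Set.Icc 1 n) (hfix : π c = c) (hi : 1 ≤ i) (hic : i < c) : π i < c := by
  obtain ⟨⟨hmaps, hinj, -⟩, -⟩ := hπ
  have hin : i ∈ Set.Icc 1 n := ⟨hi, hic.le.trans hc.2⟩
  by_contra! hle
  have hne : π i ≠ c := fun heq => hic.ne (hinj hin hc (heq.trans hfix.symm))
  have hright : Set.MapsTo π (Set.Icc (c + 1) n) (Set.Icc (c + 1) n) := by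
    rintro k ⟨hck, hkn⟩
    have hk : k ∈ Set.Icc 1 n := ⟨by lia, hkn⟩
    have hkc : π k ≠ c := fun heq => by
      have := hinj hk hc (heq.trans hfix.symm)
      lia
    have := h i c k hi hic hck hkn
    exact ⟨by lia, (hmaps hk).2⟩
  have := hinj.mem_of_apply_mem_of_mapsTo (Set.Icc_subset_Icc_left (by lia))
    (Set.finite_Icc _ _) hright hin ⟨by lia, (hmaps hin).2⟩
  have := this.1
  lia

/-- A 321-avoiding permutation maps no point to the right of a fixed point `c` to its left. -/
lemma Av321.lt_apply_of_lt {n : ℕ} {π : ℕ → ℕ} (h : Av321 n π) (hπ : PermOn n π) {c i : ℕ}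
    (hc : c ∈ Set.Icc 1 n) (hfix : π c = c) (hin : i ≤ n) (hci : c < i) : c < π i := by
  have hleft : Set.MapsTo π (Set.Icc 1 c) (Set.Icc 1 c) := by
    rintro k ⟨hk, hkc⟩
    refine ⟨(hπ.1.mapsTo ⟨hk, hkc.trans hc.2⟩).1, ?_⟩
    rcases hkc.eq_or_lt with rfl | hlt
    · exact hfix.le
    · exact (h.apply_lt_of_lt hπ hc hfix hk hlt).le
  have hi : i ∈ Set.Icc 1 n := ⟨by lia, hin⟩
  by_contra! hle
  have := hπ.1.injOn.mem_of_apply_mem_of_mapsTo (Set.Icc_subset_Icc_right hc.2)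
    (Set.finite_Icc _ _) hleft hi ⟨(hπ.1.mapsTo hi).1, hle⟩
  have := this.2
  lia

/-- A 321-avoiding permutation `π` of `{1, …, n}` maps each of the intervals into which
its fixed points split `{1, …, n}` onto itself: if `a` and `b` are consecutive fixed
points of `π` (allowing the conventions `a = 0` and `b = n + 1` at the boundary, and with
no fixed point strictly between), then `π` maps the interval strictly between `a` and `b`
onto itself. -/
theorem av321_fixed_point_intervals (n : ℕ) (π : ℕ → ℕ) (hπ : PermOn n π)
    (h : Av321 n π) (a b : ℕ)
    (ha : a = 0 ∨ (a ∈ Set.Icc 1 n ∧ π a = a))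
    (hb : b = n + 1 ∨ (b ∈ Set.Icc 1 n ∧ π b = b))
    (hab : a < b)
    (hbetween : ∀ j, a < j → j < b → j ≤ n → π j ≠ j) :
    Set.BijOn π (Set.Ioo a b ∩ Set.Icc 1 n) (Set.Ioo a b ∩ Set.Icc 1 n) := by
  have hmaps : Set.MapsTo π (Set.Ioo a b ∩ Set.Icc 1 n) (Set.Ioo a b ∩ Set.Icc 1 n) := by
    rintro i ⟨⟨hai, hib⟩, hi⟩
    have hπi := hπ.1.mapsTo hi
    refine ⟨⟨?_, ?_⟩, hπi⟩
    · rcases ha with rfl | ⟨ha, hfix⟩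
      · exact hπi.1
      · exact h.lt_apply_of_lt hπ ha hfix hi.2 hai
    · rcases hb with rfl | ⟨hb, hfix⟩
      · exact Nat.lt_succ_of_le hπi.2
      · exact h.apply_lt_of_lt hπ hb hfix hi.1 hib
  exact (((Set.finite_Icc 1 n).inter_of_right _).injOn_iff_bijOn_of_mapsTo hmaps).1
    (hπ.1.injOn.mono Set.inter_subset_right)
end

section
/- For a 321-avoiding permutation π of {1,...,n}, the set of left-to-right maxima of π coincides with the set of weak excedance values of π: a value π(i) satisfies π(i) > π(j) for all j < i if and only if π(i) ≥ i. -/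
/-- For a 321-avoiding permutation `π` of `{1, …, n}`, the left-to-right maxima coincide
with the weak excedance values: `π i` is a left-to-right maximum iff `π i ≥ i`. -/
theorem av321_lrMax_iff_weak_excedance (n : ℕ) (π : ℕ → ℕ) (hπ : PermOn n π)
    (h : Av321 n π) :
    ∀ i ∈ Set.Icc 1 n, (IsLRMax π i ↔ i ≤ π i) := by
  rintro i ⟨hi1, hin⟩
  obtain ⟨⟨hmaps, hinj, hsurj⟩, -⟩ := hπ
  constructor
  · intro hmax
    have hcard : (Finset.Icc 1 i).card ≤ (Finset.Icc 1 (π i)).card := by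
      refine Finset.card_le_card_of_injOn π (fun j hj => ?_) (hinj.mono fun j hj => ?_)
      · obtain ⟨hj1, hji⟩ := Finset.mem_Icc.1 hj
        refine Finset.mem_coe.2 (Finset.mem_Icc.2 ⟨(hmaps ⟨hj1, hji.trans hin⟩).1, ?_⟩)
        rcases hji.eq_or_lt with rfl | hlt
        · exact le_rfl
        · exact (hmax j hj1 hlt).le
      · obtain ⟨hj1, hji⟩ := Finset.mem_Icc.1 hj
        exact ⟨hj1, hji.trans hin⟩
    simpa using hcard
  · intro hexc j hj1 hji
    by_contra hlt
    have hne : π j ≠ π i := fun heq =>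
      hji.ne (hinj ⟨hj1, hji.le.trans hin⟩ ⟨hi1, hin⟩ heq)
    have hgt : π i < π j := by omega
    -- Avoidance puts every value up to `π i` at a position up to `i` other than `j`.
    have hsub : Finset.Icc 1 (π i) ⊆ ((Finset.Icc 1 i).erase j).image π := by
      intro v hv
      obtain ⟨hv1, hvi⟩ := Finset.mem_Icc.1 hv
      obtain ⟨k, ⟨hk1, hkn⟩, rfl⟩ := hsurj ⟨hv1, hvi.trans (hmaps ⟨hi1, hin⟩).2⟩
      refine Finset.mem_image_of_mem π (Finset.mem_erase.2 ⟨?_, Finset.mem_Icc.2 ⟨hk1, ?_⟩⟩)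
      · rintro rfl
        omega
      · by_contra! hik
        have hki : π k ≠ π i := fun heq => hik.ne' (hinj ⟨hk1, hkn⟩ ⟨hi1, hin⟩ heq)
        exact h j i k hj1 hji hik hkn ⟨by omega, hgt⟩
    have hcard := (Finset.card_le_card hsub).trans Finset.card_image_le
    rw [Finset.card_erase_of_mem (Finset.mem_Icc.2 ⟨hj1, hji.le⟩)] at hcard
    simp only [Nat.card_Icc] at hcard
    omega
end

section
/- The map ϕ is a bijection from the set of Dyck n-paths onto the set of nonintersecting path pairs of size n+1. -/
/-- A Dyck path, encoded as a list of steps: `true` = upstep `u`, `false` = downstep `d`. -/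
def IsDyck (p : List Bool) : Prop :=
  p.count true = p.count false ∧ ∀ q : List Bool, q <+: p → q.count false ≤ q.count true

/-- A Dyck `n`-path: a Dyck path with `n` upsteps (and `n` downsteps). -/
def IsDyckN (n : ℕ) (p : List Bool) : Prop := IsDyck p ∧ p.count true = n

/-- A nonintersecting path pair of size `m`, encoded as a pair of lists of steps
(`true` = north step `N`, `false` = east step `E`) from a common initial point to a
common terminal point: the two paths intersect only at the initial and terminal points,
with the first path (the upper path) lying above the second (at every interior step
index `j`, the vertex of the upper path is strictly above that of the lower path). -/
def IsPathPair (m : ℕ) (P : List Bool × List Bool) : Prop :=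
  P.1.length = m ∧ P.2.length = m ∧ P.1.count true = P.2.count true ∧
  ∀ j, 0 < j → j < m → (P.2.take j).count true < (P.1.take j).count true

/-- The upper path of `φ p`: the ascents of the elevated path `u p d`, each written as a
run of `N` steps whose last step is changed to an `E` step, concatenated. -/
def phiUpper (p : List Bool) : List Bool :=
  let ep := true :: (p ++ [false])
  ((List.range ep.length).filter (fun j => ep.getD j false)).map (fun j => ep.getD (j+1) false)

/-- The path `X`: the descents of the elevated path `u p d`, each written as a run of `N`
steps whose last step is changed to an `E` step, concatenated. -/
def phiX (p : List Bool) : List Bool :=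
  let ep := true :: (p ++ [false])
  ((List.range ep.length).filter (fun j => !(ep.getD j true))).map
    (fun j => ep[j+1]? == some false)

/-- The bijection `φ` from Dyck `n`-paths to nonintersecting path pairs of size `n + 1`:
the upper path comes from the ascents of the elevated path, and the lower path is `X`
(from the descents) with its last step (necessarily an `E`) transferred to the start. -/
def phi (p : List Bool) : List Bool × List Bool :=
  (phiUpper p, (phiX p).getLastD false :: (phiX p).dropLast)

/-- The steps recorded for the upsteps of a word: `true` exactly when the next step is an upstep. -/
def ascentSteps : List Bool → List Bool
  | [] => []
  | true :: w => w.headD false :: ascentSteps w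
  | false :: w => ascentSteps w

/-- The steps recorded for the downsteps of a word: `true` exactly when the next step is a
downstep. -/
def descentSteps : List Bool → List Bool
  | [] => []
  | true :: w => descentSteps w
  | false :: w => (w.head? == some false) :: descentSteps w

/-- Started at height `h`, the word `w` ends at height `0` and stays positive before its end. -/
def EndsAtFirstZero : ℕ → List Bool → Prop
  | 0, [] => True
  | 0, _ :: _ => False
  | _ + 1, [] => False
  | h + 1, true :: w => EndsAtFirstZero (h + 2) w
  | h + 1, false :: w => EndsAtFirstZero h w

/-- The condition on the ascent steps `U` and descent steps `V` of a word that expresses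
`EndsAtFirstZero h`; the flag `c` tells whether the word starts with a downstep. -/
def StepCondition (c : Bool) (h : ℕ) (U V : List Bool) : Prop :=
  V.length = U.length + h ∧ V.count true + c.toNat = U.count true + h ∧
  V.getLast? ≠ some true ∧
  ∀ j < U.length, 1 ≤ h ∧
    (V.take (j + h - 1)).count true + c.toNat + 1 ≤ h + (U.take j).count true

theorem map_filter_range_eq_ascentSteps (w : List Bool) :
    ((List.range w.length).filter (fun j => w.getD j false)).map
      (fun j => w.getD (j + 1) false) = ascentSteps w := by
  induction w with
  | nil => rfl
  | cons b w ih =>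
    rw [List.length_cons, List.range_succ_eq_map]
    cases b <;> cases w <;>
      simp_all [ascentSteps, List.filter_map, Function.comp_def]

theorem map_filter_range_eq_descentSteps (w : List Bool) :
    ((List.range w.length).filter (fun j => !(w.getD j true))).map
      (fun j => w[j + 1]? == some false) = descentSteps w := by
  induction w with
  | nil => rfl
  | cons b w ih =>
    rw [List.length_cons, List.range_succ_eq_map]
    cases b <;> cases w <;>
      simp_all [descentSteps, List.filter_map, Function.comp_def]

theorem phiUpper_eq (p : List Bool) : phiUpper p = ascentSteps (true :: (p ++ [false])) :=
  map_filter_range_eq_ascentSteps _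

theorem phiX_eq (p : List Bool) : phiX p = descentSteps (p ++ [false]) :=
  map_filter_range_eq_descentSteps (true :: (p ++ [false]))

theorem length_ascentSteps (w : List Bool) : (ascentSteps w).length = w.count true := by
  induction w with
  | nil => rfl
  | cons b w ih => cases b <;> simp [ascentSteps, ih]

theorem exists_descentSteps_append_false (p : List Bool) :
    ∃ Y, descentSteps (p ++ [false]) = Y ++ [false] := by
  induction p with
  | nil => exact ⟨[], rfl⟩
  | cons b p ih =>
    obtain ⟨Y, hY⟩ := ih
    cases b
    · exact ⟨_ :: Y, by simp only [List.cons_append, descentSteps, hY]; rfl⟩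
    · exact ⟨Y, hY⟩

theorem phi_eq {p Y : List Bool} (hY : descentSteps (p ++ [false]) = Y ++ [false]) :
    phi p = (ascentSteps (true :: (p ++ [false])), false :: Y) := by
  simp [phi, phiUpper_eq, phiX_eq, hY]

/-- A word is determined by its ascent steps, its descent steps and its first step. -/
theorem eq_of_steps_eq {v w : List Bool} (hA : ascentSteps v = ascentSteps w)
    (hD : descentSteps v = descentSteps w)
    (hc : (v.head? == some false) = (w.head? == some false)) : v = w := by
  induction v generalizing w with
  | nil => rcases w with _ | ⟨_ | _, w⟩ <;> simp_all [ascentSteps, descentSteps]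
  | cons a v ih =>
    rcases w with _ | ⟨b, w⟩
    · cases a <;> simp_all [ascentSteps, descentSteps]
    · cases a <;> cases b <;> simp [ascentSteps, descentSteps] at hA hD hc ⊢
      · exact ih hA hD.2 (by rw [Bool.eq_iff_iff]; simpa using hD.1)
      · refine ih hA.2 hD ?_
        rcases v with _ | ⟨_ | _, v⟩ <;> rcases w with _ | ⟨_ | _, w⟩ <;>
          simp_all [ascentSteps, descentSteps]

theorem phi_injective : Function.Injective phi := by
  intro p q h
  obtain ⟨Y, hY⟩ := exists_descentSteps_append_false p
  obtain ⟨Z, hZ⟩ := exists_descentSteps_append_false q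
  rw [phi_eq hY, phi_eq hZ, Prod.mk.injEq, List.cons.injEq] at h
  have key := eq_of_steps_eq h.1 (by simp [descentSteps, hY, hZ, h.2.2]) rfl
  simpa using key

theorem stepCondition_cons_left {h : ℕ} {b : Bool} {U V : List Bool} (hh : 1 ≤ h) :
    StepCondition false h (b :: U) V ↔ StepCondition (!b) (h + 1) U V := by
  unfold StepCondition
  constructor
  · rintro ⟨h1, h2, h3, h4⟩
    refine ⟨by simp at h1 ⊢; omega, by cases b <;> simp at h2 ⊢ <;> omega, h3, fun j hj => ?_⟩
    have := (h4 (j + 1) (by simpa using hj)).2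
    rw [show j + 1 + h - 1 = j + (h + 1) - 1 by omega] at this
    cases b <;> simp at this ⊢ <;> omega
  · rintro ⟨h1, h2, h3, h4⟩
    refine ⟨by simp at h1 ⊢; omega, by cases b <;> simp at h2 ⊢ <;> omega, h3, fun j hj => ⟨hh, ?_⟩⟩
    rcases j with _ | j
    · have := (List.count_le_length (a := true) (l := V.take (0 + h - 1)))
      rw [List.length_take] at this
      simp at this ⊢
      omega
    · have := (h4 j (by simpa using hj)).2
      rw [show j + 1 + h - 1 = j + (h + 1) - 1 by omega]
      cases b <;> simp at this ⊢ <;> omega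

theorem stepCondition_cons_right {h : ℕ} {b : Bool} {U V : List Bool} :
    StepCondition true (h + 1) U (b :: V) ↔ StepCondition b h U V := by
  unfold StepCondition
  constructor
  · rintro ⟨h1, h2, h3, h4⟩
    refine ⟨by simp at h1 ⊢; omega, by cases b <;> simp at h2 ⊢ <;> omega, ?_, fun j hj => ?_⟩
    · cases V
      · simp
      · simpa using h3
    · have hh : 1 ≤ h := by
        rcases h with _ | h
        · have := (h4 0 (by omega)).2
          simp at this
        · omega
      refine ⟨hh, ?_⟩
      have := (h4 j hj).2
      rw [show j + (h + 1) - 1 = (j + h - 1) + 1 by omega] at this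
      cases b <;> simp at this ⊢ <;> omega
  · rintro ⟨h1, h2, h3, h4⟩
    refine ⟨by simp at h1 ⊢; omega, by cases b <;> simp at h2 ⊢ <;> omega, ?_, fun j hj => ?_⟩
    · cases V
      · cases b
        · simp
        · obtain ⟨rfl, rfl⟩ : U = [] ∧ h = 0 := by simpa using h1.symm
          simp at h2
      · simpa using h3
    · have hj' := h4 j hj
      refine ⟨by omega, ?_⟩
      have := hj'.2
      rw [show j + (h + 1) - 1 = (j + h - 1) + 1 by omega]
      cases b <;> simp at this ⊢ <;> omega

theorem StepCondition.eq_nil {h : ℕ} {V : List Bool} (H : StepCondition false h [] V) :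
    h = 0 ∧ V = [] := by
  obtain ⟨h1, h2, h3, -⟩ := H
  have hV : V = [] := by
    rcases V.eq_nil_or_concat with rfl | ⟨W, b, rfl⟩
    · rfl
    · have := List.count_le_length (a := true) (l := W)
      cases b <;> simp at h1 h2 h3
      omega
  subst hV
  simpa using h1.symm

theorem EndsAtFirstZero.stepCondition {h : ℕ} {w : List Bool} (H : EndsAtFirstZero h w) :
    StepCondition (w.head? == some false) h (ascentSteps w) (descentSteps w) := by
  induction w generalizing h with
  | nil =>
    cases h
    · simp [StepCondition, ascentSteps, descentSteps]
    · exact H.elim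
  | cons b w ih =>
    rcases h with _ | h
    · exact H.elim
    cases b
    · exact stepCondition_cons_right.2 (ih H)
    · refine (stepCondition_cons_left (by omega)).2 ?_
      have := ih H
      rcases w with _ | ⟨_ | _, w⟩
      · exact H.elim
      · exact this
      · exact this

theorem StepCondition.exists_word {c : Bool} {h : ℕ} {U V : List Bool}
    (H : StepCondition c h U V) :
    ∃ w, EndsAtFirstZero h w ∧ ascentSteps w = U ∧ descentSteps w = V ∧
      (w.head? == some false) = c := by
  induction hN : U.length + V.length generalizing c h U V with
  | zero =>
    have hU : U = [] := List.length_eq_zero_iff.1 (by omega)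
    have hV : V = [] := List.length_eq_zero_iff.1 (by omega)
    subst hU hV
    have h0 : h = 0 := by simpa using H.1.symm
    have hc : c = false := by
      have := H.2.1
      cases c <;> simp at this ⊢
      omega
    subst h0 hc
    exact ⟨[], trivial, rfl, rfl, rfl⟩
  | succ N ih =>
    cases c
    · rcases U with _ | ⟨b, U⟩
      · obtain ⟨-, rfl⟩ := H.eq_nil
        simp at hN
      have hh : 1 ≤ h := (H.2.2.2 0 (by simp)).1
      obtain ⟨w, hw, rfl, rfl, hb⟩ := ih ((stepCondition_cons_left hh).1 H)
        (by simp at hN; omega)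
      refine ⟨true :: w, ?_, ?_, rfl, rfl⟩
      · obtain ⟨k, rfl⟩ := Nat.exists_eq_add_of_le' hh
        exact hw
      · rcases w with _ | ⟨_ | _, w⟩
        · exact hw.elim
        all_goals cases b <;> simp_all [ascentSteps]
    · rcases V with _ | ⟨b, V⟩
      · obtain ⟨rfl, rfl⟩ : U = [] ∧ h = 0 := by simpa using H.1.symm
        simpa using H.2.1
      rcases h with _ | h
      · rcases U with _ | ⟨a, U⟩
        · simpa using H.1
        · simpa using (H.2.2.2 0 (by simp)).1
      obtain ⟨w, hw, rfl, rfl, hb⟩ := ih (stepCondition_cons_right.1 H)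
        (by simp at hN; omega)
      exact ⟨false :: w, hw, rfl, by rw [descentSteps, hb], rfl⟩

theorem endsAtFirstZero_append_false_iff (h : ℕ) (p : List Bool) :
    EndsAtFirstZero (h + 1) (p ++ [false]) ↔
      h + p.count true = p.count false ∧
        ∀ q : List Bool, q <+: p → q.count false ≤ h + q.count true := by
  induction p generalizing h with
  | nil => cases h <;> simp [EndsAtFirstZero]
  | cons b p ih =>
    cases b
    · rcases h with _ | h
      · have : ¬ EndsAtFirstZero 0 (p ++ [false]) := by cases p <;> simp [EndsAtFirstZero]
        simp only [List.cons_append, EndsAtFirstZero, this, false_iff, not_and]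
        intro _ H
        simpa using H [false] (by simp)
      · simp only [List.cons_append, EndsAtFirstZero, ih, List.prefix_cons_iff]
        refine and_congr (by simp; omega) ⟨?_, ?_⟩
        · rintro H q (rfl | ⟨q, rfl, hq⟩)
          · simp
          · have := H q hq
            simp
            omega
        · intro H q hq
          have := H (false :: q) (Or.inr ⟨q, rfl, hq⟩)
          simp at this
          omega
    · simp only [List.cons_append, EndsAtFirstZero, ih, List.prefix_cons_iff]
      refine and_congr (by simp; omega) ⟨?_, ?_⟩
      · rintro H q (rfl | ⟨q, rfl, hq⟩)
        · simp
        · have := H q hq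
          simp
          omega
      · intro H q hq
        have := H (true :: q) (Or.inr ⟨q, rfl, hq⟩)
        simp at this
        omega

theorem isDyck_iff_endsAtFirstZero (p : List Bool) :
    IsDyck p ↔ EndsAtFirstZero 1 (p ++ [false]) := by
  simp [IsDyck, endsAtFirstZero_append_false_iff 0 p]

theorem EndsAtFirstZero.exists_append_false {h : ℕ} {w : List Bool}
    (H : EndsAtFirstZero (h + 1) w) : ∃ p, w = p ++ [false] := by
  induction w generalizing h with
  | nil => exact H.elim
  | cons b w ih =>
    cases b
    · rcases h with _ | h
      · cases w
        · exact ⟨[], rfl⟩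
        · exact H.elim
      · obtain ⟨p, rfl⟩ := ih (h := h) H
        exact ⟨false :: p, rfl⟩
    · obtain ⟨p, rfl⟩ := ih (h := h + 1) H
      exact ⟨true :: p, rfl⟩

theorem isPathPair_iff_stepCondition (b : Bool) (U Y : List Bool) (n : ℕ) (hU : U.length = n) :
    IsPathPair (n + 1) (b :: U, false :: Y) ↔ StepCondition (!b) 1 U (Y ++ [false]) := by
  subst hU
  have htake (j : ℕ) : ((Y ++ [false]).take j).count true = (Y.take j).count true := by
    rw [List.take_append, List.count_append]
    rcases j - Y.length with _ | k <;> simp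
  simp only [IsPathPair, StepCondition, Nat.add_sub_cancel, htake]
  constructor
  · rintro ⟨-, h2, h3, h4⟩
    refine ⟨by simpa using h2, by cases b <;> simp at h3 ⊢ <;> omega, by simp,
      fun j hj => ⟨le_rfl, ?_⟩⟩
    have := h4 (j + 1) (by omega) (by omega)
    cases b <;> simp at this ⊢ <;> omega
  · rintro ⟨h1, h2, -, h4⟩
    refine ⟨by simp, by simpa using h1, by cases b <;> simp at h2 ⊢ <;> omega, fun j hj hj' => ?_⟩
    obtain ⟨j, rfl⟩ := Nat.exists_eq_add_of_le' hj
    have := (h4 j (by omega)).2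
    cases b <;> simp at this ⊢ <;> omega

theorem EndsAtFirstZero.headD_eq {h : ℕ} {w : List Bool} (H : EndsAtFirstZero (h + 1) w) :
    (!w.headD false) = (w.head? == some false) := by
  rcases w with _ | ⟨_ | _, w⟩
  · exact H.elim
  · rfl
  · rfl

/-- The map `φ` is a bijection from the set of Dyck `n`-paths onto the set of
nonintersecting path pairs of size `n + 1`. -/
theorem phi_bijOn (n : ℕ) (hn : 1 ≤ n) :
    Set.BijOn phi {p : List Bool | IsDyckN n p}
      {P : List Bool × List Bool | IsPathPair (n+1) P} := by
  refine ⟨?_, phi_injective.injOn, ?_⟩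
  · rintro p ⟨hp, hpn⟩
    rw [isDyck_iff_endsAtFirstZero] at hp
    obtain ⟨Y, hY⟩ := exists_descentSteps_append_false p
    rw [Set.mem_ofPred_eq, phi_eq hY, ascentSteps, isPathPair_iff_stepCondition _ _ _ _
      (by simp [length_ascentSteps, hpn]), hp.headD_eq, ← hY]
    exact hp.stepCondition
  · rintro ⟨U, L⟩ H
    obtain ⟨hU, hL, -, hlt⟩ := id H
    rcases U with _ | ⟨b, U⟩
    · simp at hU
    rcases L with _ | ⟨a, Y⟩
    · simp at hL
    have ha : a = false := by
      have := hlt 1 (by omega) (by omega)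
      cases a
      · rfl
      · cases b <;> simp at this
    subst ha
    have hUn : U.length = n := by simpa using hU
    obtain ⟨w, hw, hwU, hwY, hwb⟩ := ((isPathPair_iff_stepCondition b U Y n hUn).1 H).exists_word
    obtain ⟨p, rfl⟩ := hw.exists_append_false
    refine ⟨p, ⟨(isDyck_iff_endsAtFirstZero p).2 hw, ?_⟩, ?_⟩
    · rw [← hUn, ← hwU, length_ascentSteps]
      simp
    · rw [phi_eq hwY, ascentSteps, hwU, Bool.not_inj (hw.headD_eq.trans hwb)]
end

section
/- Under the bijection ϕ, the reverse-path involution on Dyck n-paths corresponds to 180° rotation of path pairs: for every Dyck n-path P, ϕ(R(P)) is the path pair obtained by rotating ϕ(P) by 180°. -/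
/-- The "reverse path" involution `R`: read the path right to left, interchanging the
roles of upsteps and downsteps. -/
def Rmap (p : List Bool) : List Bool := (p.map (fun b => !b)).reverse

/-- For each upstep of a path, in order, record whether the next step is an upstep. -/
def upSucc : List Bool → List Bool
  | [] => []
  | true :: l => l.headD false :: upSucc l
  | false :: l => upSucc l

/-- For each downstep of a path, in order, record whether the next step is a downstep. -/
def downSucc : List Bool → List Bool
  | [] => []
  | false :: l => (l.head? == some false) :: downSucc l
  | true :: l => downSucc l

/-- For each downstep of a path preceded by the step `c`, in order, record whether the
previous step is a downstep. -/
def downPred : Bool → List Bool → List Bool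
  | _, [] => []
  | c, false :: l => (!c) :: downPred false l
  | _, true :: l => downPred true l

theorem map_filter_range_eq_upSucc (l : List Bool) :
    ((List.range l.length).filter (fun j => l.getD j false)).map
      (fun j => l.getD (j + 1) false) = upSucc l := by
  induction l with
  | nil => rfl
  | cons a l ih =>
    rw [List.length_cons, List.range_succ_eq_map, List.filter_cons, List.filter_map]
    cases a <;> cases l <;> simp_all [upSucc, Function.comp_def]

theorem map_filter_range_eq_downSucc (l : List Bool) :
    ((List.range l.length).filter (fun j => !(l.getD j true))).map
      (fun j => l[j + 1]? == some false) = downSucc l := by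
  induction l with
  | nil => rfl
  | cons a l ih =>
    rw [List.length_cons, List.range_succ_eq_map, List.filter_cons, List.filter_map]
    cases a <;> cases l <;> simp_all [downSucc, Function.comp_def]

theorem phiUpper_eq_upSucc (p : List Bool) : phiUpper p = upSucc (true :: (p ++ [false])) :=
  map_filter_range_eq_upSucc _

theorem phiX_eq_downSucc (p : List Bool) : phiX p = downSucc (true :: (p ++ [false])) :=
  map_filter_range_eq_downSucc _

theorem downPred_append_singleton_false (c : Bool) (l : List Bool) :
    downPred c l ++ [false] = downSucc (false :: if c then true :: l else l) := by
  induction l generalizing c with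
  | nil => cases c <;> rfl
  | cons a l ih =>
    have ht := ih true
    have hf := ih false
    cases a <;> cases c <;> simp_all [downPred, downSucc]

theorem getLastD_cons_dropLast_downSucc (l : List Bool) (h : downSucc l ≠ []) :
    (downSucc l).getLastD false :: (downSucc l).dropLast = downPred true l := by
  have key : downPred true l ++ [false] = false :: downSucc l := by
    simpa [downSucc] using downPred_append_singleton_false true l
  obtain ⟨d, x, hd⟩ := (downSucc l).eq_nil_or_concat.resolve_left h
  rw [List.concat_eq_append] at hd
  rw [hd, ← List.cons_append] at key
  obtain ⟨hpred, hx⟩ := List.append_inj' key rfl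
  simp_all

theorem downSucc_append_singleton_ne_nil (l : List Bool) : downSucc (l ++ [false]) ≠ [] := by
  induction l with
  | nil => simp [downSucc]
  | cons a l ih => cases a <;> simp [downSucc, ih]

theorem phi_snd_eq_downPred (p : List Bool) :
    (phi p).2 = downPred true (true :: (p ++ [false])) := by
  rw [phi, phiX_eq_downSucc]
  exact getLastD_cons_dropLast_downSucc _ (downSucc_append_singleton_ne_nil (true :: p))

theorem upSucc_Rmap_append (l s : List Bool) :
    upSucc (Rmap l ++ s) = (downPred (!s.headD false) l).reverse ++ upSucc s := by
  induction l generalizing s with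
  | nil => rfl
  | cons a l ih =>
    have hcons : Rmap (a :: l) ++ s = Rmap l ++ (!a) :: s := by simp [Rmap]
    rw [hcons, ih]
    cases a <;> simp [upSucc, downPred]

theorem Rmap_Rmap (p : List Bool) : Rmap (Rmap p) = p := by
  simp [Rmap, Function.comp_def]

theorem phi_Rmap_fst (p : List Bool) : (phi (Rmap p)).1 = (phi p).2.reverse := by
  have helev : true :: (Rmap p ++ [false]) = Rmap (true :: (p ++ [false])) := by simp [Rmap]
  rw [phi_snd_eq_downPred, phi, phiUpper_eq_upSucc, helev]
  simpa [upSucc] using upSucc_Rmap_append (true :: (p ++ [false])) []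

/-- Under `φ`, the reverse-path involution on Dyck `n`-paths corresponds to 180°
rotation of path pairs: rotating a path pair by 180° (and translating back) reverses
each path and interchanges the upper and lower paths. -/
theorem phi_rmap_eq_rotate (n : ℕ) (p : List Bool) (hp : IsDyckN n p) :
    phi (Rmap p) = ((phi p).2.reverse, (phi p).1.reverse) := by
  refine Prod.ext (phi_Rmap_fst p) ?_
  have h := phi_Rmap_fst (Rmap p)
  rw [Rmap_Rmap] at h
  simp [h]
end

section
/- The Lalanne–Kreweras map L is a size-preserving involution on Dyck paths: for every Dyck n-path P, L(P) is a Dyck n-path and L(L(P)) = P. -/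
/-- The (0-indexed) positions `j` such that step `j` is `a` and step `j+1` is `b`. -/
def adjPositions (a b : Bool) (p : List Bool) : List ℕ :=
  (List.range p.length).filter (fun j => p[j]? == some a && p[j+1]? == some b)

/-- Labels of the first downstep of each occurrence of `dd` (downsteps labelled left to
right by 1, 2, …). -/
def lkA (p : List Bool) : List ℕ :=
  (adjPositions false false p).map (fun j => (p.take (j+1)).count false)

/-- Labels of the first upstep of each occurrence of `uu` (upsteps labelled left to
right by 1, 2, …). -/
def lkD (p : List Bool) : List ℕ :=
  (adjPositions true true p).map (fun j => (p.take (j+1)).count true)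

/-- The Dyck path of size `n` whose partial-sum ascent-descent code is `(A, D)`:
its ascent lengths are the successive differences of `A ++ [n]`, and its descent
lengths are the successive differences of `D ++ [n]`. -/
def pathOfCode (n : ℕ) (A D : List ℕ) : List Bool :=
  let A' := A ++ [n]
  let D' := D ++ [n]
  let a := List.zipWith (· - ·) A' (0 :: A')
  let d := List.zipWith (· - ·) D' (0 :: D')
  (List.zipWith (fun x y => List.replicate x true ++ List.replicate y false) a d).flatten

/-- The Lalanne–Kreweras involution `L` on Dyck paths: the image is the Dyck path
whose partial-sum ascent-descent code is `(lkA p, lkD p)`. -/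
def Lmap (p : List Bool) : List Bool := pathOfCode (p.count true) (lkA p) (lkD p)

/-- The labels, starting from `c + 1`, of the steps `b` that are followed by another `b`. -/
def doubleLabels (b : Bool) : ℕ → List Bool → List ℕ
  | _, [] => []
  | c, x :: l =>
    if x = b then
      if l.head? = some b then (c + 1) :: doubleLabels b (c + 1) l else doubleLabels b (c + 1) l
    else doubleLabels b c l

/-- The tail, from a valley with `s` upsteps and `t` downsteps before it, of the path of size `n`
with partial-sum code `(A, D)`. -/
def codePath (n : ℕ) : ℕ → ℕ → List ℕ → List ℕ → List Bool
  | s, t, a :: A, d :: D =>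
    List.replicate (a - s) true ++ (List.replicate (d - t) false ++ codePath n a d A D)
  | s, t, _, _ => List.replicate (n - s) true ++ List.replicate (n - t) false

/-- `A` is strictly increasing with entries strictly between `s` and `n`. -/
def IsCode (n s : ℕ) (A : List ℕ) : Prop :=
  A.Pairwise (· < ·) ∧ ∀ a ∈ A, s < a ∧ a < n

/-- The increasing list of the integers strictly between `s` and `n` that are not in `A`. -/
def codeCompl (n s : ℕ) (A : List ℕ) : List ℕ :=
  (List.range' (s + 1) (n - 1 - s)).filter (fun x => decide (x ∉ A))

/-- Starting after `s` upsteps and `t` downsteps, the path `l` stays weakly above the axis. -/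
def StaysAbove (s t : ℕ) (l : List Bool) : Prop :=
  ∀ q : List Bool, q <+: l → t + q.count false ≤ s + q.count true

theorem codePath_nil (n s t : ℕ) :
    codePath n s t [] [] = List.replicate (n - s) true ++ List.replicate (n - t) false := by
  simp [codePath]

theorem doubleLabels_eq_map (b : Bool) (c : ℕ) (p : List Bool) :
    doubleLabels b c p = (adjPositions b b p).map (fun j => c + (p.take (j + 1)).count b) := by
  induction p generalizing c with
  | nil => simp [doubleLabels, adjPositions]
  | cons x l ih =>
    have hpos : adjPositions b b (x :: l) =
        (if x = b ∧ l.head? = some b then [0] else []) ++ (adjPositions b b l).map (· + 1) := by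
      simp only [adjPositions, List.length_cons, List.range_succ_eq_map, List.filter_cons,
        List.filter_map]
      cases l <;> cases x <;> cases b <;> simp [Function.comp_def] <;>
        split_ifs <;> rfl
    rw [hpos, doubleLabels]
    by_cases hx : x = b
    · subst hx
      by_cases hl : l.head? = some x
      · simp [hl, ih, Function.comp_def]
        intros; omega
      · simp [hl, ih, Function.comp_def]
        intros; omega
    · simp [hx, ih, Function.comp_def]

theorem lkA_eq_doubleLabels (p : List Bool) : lkA p = doubleLabels false 0 p := by
  simp [doubleLabels_eq_map, lkA]

theorem lkD_eq_doubleLabels (p : List Bool) : lkD p = doubleLabels true 0 p := by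
  simp [doubleLabels_eq_map, lkD]

theorem doubleLabels_replicate_of_ne {b b' : Bool} (h : b' ≠ b) (c k : ℕ) (l : List Bool) :
    doubleLabels b c (List.replicate k b' ++ l) = doubleLabels b c l := by
  induction k with
  | zero => simp
  | succ k ih => simp [List.replicate_succ, doubleLabels, h, ih]

theorem doubleLabels_replicate_append (b : Bool) (c k : ℕ) (l : List Bool)
    (hl : l.head? ≠ some b) :
    doubleLabels b c (List.replicate (k + 1) b ++ l) =
      List.range' (c + 1) k ++ doubleLabels b (c + (k + 1)) l := by
  induction k generalizing c with
  | zero => simp [doubleLabels, hl]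
  | succ k ih =>
    rw [List.replicate_succ, List.cons_append, doubleLabels, ih]
    simp [List.range'_succ, List.replicate_succ, add_comm, add_left_comm]

theorem IsCode.tail {n s a : ℕ} {A : List ℕ} (h : IsCode n s (a :: A)) : IsCode n a A := by
  simp only [IsCode, List.pairwise_cons, List.mem_cons, forall_eq_or_imp] at *
  exact ⟨h.1.2, fun x hx => ⟨h.1.1 x hx, (h.2.2 x hx).2⟩⟩

theorem IsCode.head {n s a : ℕ} {A : List ℕ} (h : IsCode n s (a :: A)) : s < a ∧ a < n :=
  h.2 a (by simp)

theorem IsCode.cons {n s a : ℕ} {A : List ℕ} (h : IsCode n a A) (hs : s < a) (ha : a < n) :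
    IsCode n s (a :: A) := by
  simp only [IsCode, List.pairwise_cons, List.mem_cons, forall_eq_or_imp] at *
  exact ⟨⟨fun x hx => (h.2 x hx).1, h.1⟩, ⟨hs, ha⟩,
    fun x hx => ⟨hs.trans (h.2 x hx).1, (h.2 x hx).2⟩⟩

theorem head?_codePath {n s t : ℕ} {A D : List ℕ} (hA : IsCode n s A) (hs : s < n) :
    (codePath n s t A D).head? = some true := by
  unfold codePath
  split
  · obtain ⟨k, hk⟩ := Nat.exists_eq_add_of_lt hA.head.1
    simp [hk, add_assoc, List.replicate_succ]
  · obtain ⟨k, hk⟩ := Nat.exists_eq_add_of_lt hs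
    simp [hk, add_assoc, List.replicate_succ]

theorem codeCompl_nil (n s : ℕ) : codeCompl n s [] = List.range' (s + 1) (n - 1 - s) := by
  simp [codeCompl]

theorem codeCompl_cons {n s a : ℕ} {A : List ℕ} (h : IsCode n s (a :: A)) :
    codeCompl n s (a :: A) = List.range' (s + 1) (a - 1 - s) ++ codeCompl n a A := by
  obtain ⟨h1, h2⟩ := h.head
  have hsplit : List.range' (s + 1) (n - 1 - s) =
      List.range' (s + 1) (a - 1 - s) ++ a :: List.range' (a + 1) (n - 1 - a) := by
    rw [← List.range'_succ, show n - 1 - s = (a - 1 - s) + (n - 1 - a + 1) by omega,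
      ← List.range'_append]
    congr 2
    omega
  rw [codeCompl, codeCompl, hsplit, List.filter_append, List.filter_cons]
  simp only [List.mem_cons, true_or, not_true_eq_false, decide_false, Bool.false_eq_true, if_false]
  congr 1
  · rw [List.filter_eq_self]
    intro x hx
    rw [List.mem_range'_1] at hx
    have : x ∉ A := fun hxA => by have := h.tail.2 x hxA; omega
    simp [this]
    omega
  · apply List.filter_congr
    intro x hx
    rw [List.mem_range'_1] at hx
    have : x ≠ a := by omega
    simp [this]

theorem doubleLabels_true_codePath {n s t : ℕ} {A D : List ℕ} (hA : IsCode n s A)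
    (hD : IsCode n t D) (hlen : A.length = D.length) (hs : s < n) (ht : t < n) :
    doubleLabels true s (codePath n s t A D) = codeCompl n s A := by
  induction A generalizing s t D with
  | nil =>
    obtain rfl : D = [] := by simpa using hlen.symm
    obtain ⟨k, rfl⟩ := Nat.exists_eq_add_of_lt hs
    obtain ⟨m, hm⟩ := Nat.exists_eq_add_of_lt ht
    rw [codePath_nil, codeCompl_nil, hm, show t + m + 1 - s = k + 1 by omega,
      doubleLabels_replicate_append, ← List.append_nil (List.replicate _ false),
      doubleLabels_replicate_of_ne (by simp)]
    · simp [doubleLabels, show t + m - s = k by omega]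
    · simp [add_assoc, List.replicate_succ]
  | cons a A ih =>
    obtain _ | ⟨d, D⟩ := D
    · simp at hlen
    obtain ⟨k, hk⟩ := Nat.exists_eq_add_of_lt hA.head.1
    obtain ⟨m, hm⟩ := Nat.exists_eq_add_of_lt hD.head.1
    rw [codePath, codeCompl_cons hA, show a - s = k + 1 by omega, doubleLabels_replicate_append,
      doubleLabels_replicate_of_ne (by simp), show s + (k + 1) = a by omega,
      ih hA.tail hD.tail (by simpa using hlen) hA.head.2 hD.head.2,
      show a - 1 - s = k by omega]
    rw [show d - t = m + 1 by omega]
    simp [List.replicate_succ]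

theorem doubleLabels_false_codePath {n s t : ℕ} {A D : List ℕ} (hA : IsCode n s A)
    (hD : IsCode n t D) (hlen : A.length = D.length) (ht : t < n) :
    doubleLabels false t (codePath n s t A D) = codeCompl n t D := by
  induction A generalizing s t D with
  | nil =>
    obtain rfl : D = [] := by simpa using hlen.symm
    obtain ⟨m, rfl⟩ := Nat.exists_eq_add_of_lt ht
    rw [codePath_nil, codeCompl_nil, doubleLabels_replicate_of_ne (by simp),
      show t + m + 1 - t = m + 1 by omega, ← List.append_nil (List.replicate _ false),
      doubleLabels_replicate_append _ _ _ _ (by simp)]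
    simp [doubleLabels]
  | cons a A ih =>
    obtain _ | ⟨d, D⟩ := D
    · simp at hlen
    obtain ⟨m, hm⟩ := Nat.exists_eq_add_of_lt hD.head.1
    rw [codePath, codeCompl_cons hD, doubleLabels_replicate_of_ne (by simp),
      show d - t = m + 1 by omega, doubleLabels_replicate_append,
      show t + (m + 1) = d by omega,
      ih hA.tail hD.tail (by simpa using hlen) hD.head.2, show d - 1 - t = m by omega]
    simp [head?_codePath hA.tail hA.head.2]

theorem count_true_codePath {n s t : ℕ} {A D : List ℕ} (hA : IsCode n s A) (hs : s ≤ n)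
    (hlen : A.length = D.length) : s + (codePath n s t A D).count true = n := by
  induction A generalizing s t D with
  | nil => simp [codePath, List.count_replicate, hs]
  | cons a A ih =>
    obtain _ | ⟨d, D⟩ := D
    · simp at hlen
    have := ih (t := d) hA.tail hA.head.2.le (by simpa using hlen)
    have := hA.head
    simp [codePath, List.count_replicate]
    omega

theorem count_false_codePath {n s t : ℕ} {A D : List ℕ} (hD : IsCode n t D) (ht : t ≤ n)
    (hlen : A.length = D.length) : t + (codePath n s t A D).count false = n := by
  induction A generalizing s t D with
  | nil =>
    obtain rfl : D = [] := by simpa using hlen.symm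
    simp [codePath, List.count_replicate, ht]
  | cons a A ih =>
    obtain _ | ⟨d, D⟩ := D
    · simp at hlen
    have := ih (s := a) hD.tail hD.head.2.le (by simpa using hlen)
    have := hD.head
    simp [codePath, List.count_replicate]
    omega

theorem zipWith_differences_flatten {n s t : ℕ} {A D : List ℕ} (hlen : A.length = D.length) :
    (List.zipWith (fun x y => List.replicate x true ++ List.replicate y false)
      (List.zipWith (· - ·) (A ++ [n]) (s :: (A ++ [n])))
      (List.zipWith (· - ·) (D ++ [n]) (t :: (D ++ [n])))).flatten = codePath n s t A D := by
  induction A generalizing s t D with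
  | nil =>
    obtain rfl : D = [] := by simpa using hlen.symm
    simp [codePath]
  | cons a A ih =>
    obtain _ | ⟨d, D⟩ := D
    · simp at hlen
    have := ih (s := a) (t := d) (D := D) (by simpa using hlen)
    simp [codePath, ← this]

theorem pathOfCode_eq_codePath {n : ℕ} {A D : List ℕ} (hlen : A.length = D.length) :
    pathOfCode n A D = codePath n 0 0 A D :=
  zipWith_differences_flatten hlen

theorem Lmap_codePath {n : ℕ} {A D : List ℕ} (hA : IsCode n 0 A) (hD : IsCode n 0 D)
    (hlen : A.length = D.length) (hn : 0 < n) :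
    Lmap (codePath n 0 0 A D) = pathOfCode n (codeCompl n 0 D) (codeCompl n 0 A) := by
  have hcount := count_true_codePath (t := 0) hA hn.le hlen
  rw [zero_add] at hcount
  rw [Lmap, hcount, lkA_eq_doubleLabels, lkD_eq_doubleLabels,
    doubleLabels_true_codePath hA hD hlen hn hn, doubleLabels_false_codePath hA hD hlen hn]

theorem StaysAbove.le {s t : ℕ} {l : List Bool} (h : StaysAbove s t l) : t ≤ s := by
  simpa using h [] (List.nil_prefix)

theorem staysAbove_cons_true {s t : ℕ} {l : List Bool} :
    StaysAbove s t (true :: l) ↔ t ≤ s ∧ StaysAbove (s + 1) t l := by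
  refine ⟨fun h => ⟨h.le, fun q hq => ?_⟩, fun h q hq => ?_⟩
  · have := h (true :: q) (by simpa using hq)
    simp at this
    omega
  · obtain _ | ⟨x, q⟩ := q
    · simpa using h.1
    · obtain ⟨rfl, hql⟩ := List.cons_prefix_cons.1 hq
      have := h.2 q hql
      simp
      omega

theorem staysAbove_cons_false {s t : ℕ} {l : List Bool} :
    StaysAbove s t (false :: l) ↔ StaysAbove s (t + 1) l := by
  refine ⟨fun h q hq => ?_, fun h q hq => ?_⟩
  · have := h (false :: q) (by simpa using hq)
    simp at this
    omega
  · obtain _ | ⟨x, q⟩ := q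
    · have := h.le
      simp
      omega
    · obtain ⟨rfl, hql⟩ := List.cons_prefix_cons.1 hq
      have := h q hql
      simp
      omega

theorem staysAbove_replicate_true {s t k : ℕ} {l : List Bool} (h : t ≤ s) :
    StaysAbove s t (List.replicate k true ++ l) ↔ StaysAbove (s + k) t l := by
  induction k generalizing s with
  | zero => simp
  | succ k ih =>
    rw [List.replicate_succ, List.cons_append, staysAbove_cons_true, ih (by omega),
      show s + 1 + k = s + (k + 1) by omega]
    simp [h]

theorem staysAbove_replicate_false {s t k : ℕ} {l : List Bool} :
    StaysAbove s t (List.replicate k false ++ l) ↔ StaysAbove s (t + k) l := by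
  induction k generalizing t with
  | zero => simp
  | succ k ih =>
    rw [List.replicate_succ, List.cons_append, staysAbove_cons_false, ih,
      show t + 1 + k = t + (k + 1) by omega]

theorem staysAbove_codePath {n s t : ℕ} {A D : List ℕ} (hA : IsCode n s A)
    (hD : IsCode n t D) (hlen : A.length = D.length) (hts : t ≤ s) (hs : s ≤ n) :
    StaysAbove s t (codePath n s t A D) ↔ List.Forall₂ (· ≤ ·) D A := by
  induction A generalizing s t D with
  | nil =>
    obtain rfl : D = [] := by simpa using hlen.symm
    rw [codePath_nil, staysAbove_replicate_true hts, ← List.append_nil (List.replicate _ false),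
      staysAbove_replicate_false]
    simp [StaysAbove]
    omega
  | cons a A ih =>
    obtain _ | ⟨d, D⟩ := D
    · simp at hlen
    have h1 := hA.head
    have h2 := hD.head
    rw [codePath, staysAbove_replicate_true hts, staysAbove_replicate_false,
      show s + (a - s) = a by omega, show t + (d - t) = d by omega, List.forall₂_cons]
    have key := fun hda : d ≤ a =>
      ih hA.tail hD.tail (by simpa using hlen) hda h1.2.le
    exact ⟨fun h => ⟨h.le, (key h.le).1 h⟩, fun h => (key h.1).2 h.2⟩

theorem forall₂_le_iff_countP {D A : List ℕ} (hA : A.Pairwise (· < ·))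
    (hD : D.Pairwise (· < ·)) (hlen : A.length = D.length) :
    List.Forall₂ (· ≤ ·) D A ↔
      ∀ x, A.countP (fun y => decide (y ≤ x)) ≤ D.countP (fun y => decide (y ≤ x)) := by
  induction A generalizing D with
  | nil =>
    obtain rfl : D = [] := by simpa using hlen.symm
    simp
  | cons a A ih =>
    obtain _ | ⟨d, D⟩ := D
    · simp at hlen
    rw [List.pairwise_cons] at hA hD
    rw [List.forall₂_cons, ih hA.2 hD.2 (by simpa using hlen)]
    simp only [List.countP_cons, decide_eq_true_eq]
    refine ⟨fun h x => ?_, fun h => ?_⟩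
    · have := h.2 x
      split_ifs <;> omega
    · have hda : d ≤ a := by
        by_contra hlt
        have h0 : D.countP (fun y => decide (y ≤ a)) = 0 := by
          rw [List.countP_eq_zero]
          intro y hy
          have := hD.1 y hy
          simp
          omega
        have := h a
        simp [h0, hlt] at this
      refine ⟨hda, fun x => ?_⟩
      by_cases hx : a ≤ x
      · have := h x
        simpa [hx, hda.trans hx] using this
      · have h0 : A.countP (fun y => decide (y ≤ x)) = 0 := by
          rw [List.countP_eq_zero]
          intro y hy
          have := hA.1 y hy
          simp
          omega
        omega

theorem isCode_codeCompl (n s : ℕ) (A : List ℕ) : IsCode n s (codeCompl n s A) := by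
  refine ⟨(List.pairwise_lt_range').filter _, fun a ha => ?_⟩
  have := (List.mem_filter.1 ha).1
  rw [List.mem_range'_1] at this
  omega

theorem mem_codeCompl {n s x : ℕ} {A : List ℕ} :
    x ∈ codeCompl n s A ↔ (s < x ∧ x < n) ∧ x ∉ A := by
  rw [codeCompl, List.mem_filter, List.mem_range'_1, decide_eq_true_eq]
  exact and_congr_left fun _ => by omega

theorem IsCode.ext {n s : ℕ} {A B : List ℕ} (hA : IsCode n s A) (hB : IsCode n s B)
    (h : ∀ x, x ∈ A ↔ x ∈ B) : A = B :=
  hA.1.eq_of_mem_iff hB.1 (fun {x} => h x)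

theorem codeCompl_codeCompl {n s : ℕ} {A : List ℕ} (hA : IsCode n s A) :
    codeCompl n s (codeCompl n s A) = A := by
  refine (isCode_codeCompl _ _ _).ext hA fun x => ?_
  have := hA.2 x
  simp only [mem_codeCompl]
  tauto

theorem IsCode.eq_filter {n s : ℕ} {A : List ℕ} (hA : IsCode n s A) :
    A = (List.range' (s + 1) (n - 1 - s)).filter (fun x => decide (x ∈ A)) := by
  conv_lhs => rw [← codeCompl_codeCompl hA, codeCompl]
  refine List.filter_congr fun x hx => ?_
  rw [List.mem_range'_1] at hx
  simp only [mem_codeCompl]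
  have : s < x ∧ x < n := by omega
  simp [this]

theorem countP_add_countP_codeCompl {n s : ℕ} {A : List ℕ} (hA : IsCode n s A) (f : ℕ → Bool) :
    A.countP f + (codeCompl n s A).countP f =
      (List.range' (s + 1) (n - 1 - s)).countP f := by
  rw [List.countP_eq_countP_filter_add (List.range' _ _) f (fun x => decide (x ∈ A)), ← hA.eq_filter, codeCompl]
  simp

theorem length_codeCompl {n s : ℕ} {A D : List ℕ} (hA : IsCode n s A) (hD : IsCode n s D)
    (hlen : A.length = D.length) : (codeCompl n s D).length = (codeCompl n s A).length := by
  have h1 := countP_add_countP_codeCompl hA (fun _ => true)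
  have h2 := countP_add_countP_codeCompl hD (fun _ => true)
  simp at h1 h2
  omega

theorem forall₂_codeCompl {n s : ℕ} {A D : List ℕ} (hA : IsCode n s A) (hD : IsCode n s D)
    (h : List.Forall₂ (· ≤ ·) D A) :
    List.Forall₂ (· ≤ ·) (codeCompl n s A) (codeCompl n s D) := by
  have hlen := h.length_eq.symm
  rw [forall₂_le_iff_countP hA.1 hD.1 hlen] at h
  rw [forall₂_le_iff_countP (isCode_codeCompl _ _ _).1 (isCode_codeCompl _ _ _).1
    (length_codeCompl hA hD hlen)]
  intro x
  have h1 := countP_add_countP_codeCompl hA (fun y => decide (y ≤ x))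
  have h2 := countP_add_countP_codeCompl hD (fun y => decide (y ≤ x))
  have := h x
  omega

theorem isDyckN_codePath {n : ℕ} {A D : List ℕ} (hA : IsCode n 0 A) (hD : IsCode n 0 D)
    (h : List.Forall₂ (· ≤ ·) D A) : IsDyckN n (codePath n 0 0 A D) := by
  have hlen := h.length_eq.symm
  have ht := count_true_codePath (t := 0) hA n.zero_le hlen
  have hf := count_false_codePath (s := 0) hD n.zero_le hlen
  have hab := (staysAbove_codePath hA hD hlen le_rfl n.zero_le).2 h
  refine ⟨⟨by omega, fun q hq => ?_⟩, by omega⟩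
  simpa using hab q hq

/-- A path ending with a downstep consists of downsteps followed, if it has an upstep, by a path
given by a code. -/
theorem exists_eq_codePath {n s t : ℕ} {p : List Bool} (hlast : ∀ x ∈ p.getLast?, x = false)
    (hs : s + p.count true = n) (ht : t + p.count false = n) :
    (∃ m, p = List.replicate m false) ∨
      ∃ m A D, IsCode n s A ∧ IsCode n (t + m) D ∧ A.length = D.length ∧ s < n ∧ t + m < n ∧
        p = List.replicate m false ++ codePath n s (t + m) A D := by
  induction p generalizing s t with
  | nil => exact .inl ⟨0, rfl⟩
  | cons x l ih =>
    have hlast' : ∀ y ∈ l.getLast?, y = false := by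
      intro y hy
      refine hlast y ?_
      rw [List.getLast?_cons]
      simp_all
    cases x with
    | false =>
      simp at hs ht
      obtain ⟨m, rfl⟩ | ⟨m, A, D, hA, hD, hlen, hsn, htn, rfl⟩ :=
        ih (t := t + 1) hlast' hs (by omega)
      · exact .inl ⟨m + 1, rfl⟩
      · rw [show t + 1 + m = t + (m + 1) by omega] at *
        exact .inr ⟨m + 1, A, D, hA, hD, hlen, hsn, htn, rfl⟩
    | true =>
      right
      simp at hs ht
      obtain ⟨m, rfl⟩ | ⟨m, A, D, hA, hD, hlen, hsn, htn, rfl⟩ :=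
        ih (s := s + 1) hlast' (by omega) ht
      · obtain _ | m := m
        · simp at hlast
        · simp [List.count_replicate] at hs ht
          refine ⟨0, [], [], by simp [IsCode], by simp [IsCode], rfl, by omega, by omega, ?_⟩
          rw [codePath_nil, show n - s = 1 by omega, show n - (t + 0) = m + 1 by omega]
          rfl
      · obtain _ | m := m
        · refine ⟨0, A, D, ⟨hA.1, fun a ha => ?_⟩, hD, hlen, by omega, htn, ?_⟩
          · have := hA.2 a ha
            omega
          · obtain _ | ⟨a, A⟩ := A
            · obtain rfl : D = [] := by simpa using hlen.symm
              simp [codePath, show n - s = (n - (s + 1)) + 1 by omega, List.replicate_succ]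
            · obtain _ | ⟨d, D⟩ := D
              · simp at hlen
              have := hA.head
              simp [codePath, show a - s = (a - (s + 1)) + 1 by omega, List.replicate_succ]
        · refine ⟨0, (s + 1) :: A, (t + (m + 1)) :: D, hA.cons (by omega) hsn,
            hD.cons (by omega) htn, by simpa using hlen, by omega, by omega, ?_⟩
          simp [codePath, List.replicate_succ]

theorem IsDyckN.exists_code {n : ℕ} {p : List Bool} (hp : IsDyckN n p) (hn : 0 < n) :
    ∃ A D, IsCode n 0 A ∧ IsCode n 0 D ∧ List.Forall₂ (· ≤ ·) D A ∧
      p = codePath n 0 0 A D := by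
  obtain ⟨⟨hcount, hpre⟩, htrue⟩ := hp
  have hlast : ∀ x ∈ p.getLast?, x = false := by
    intro x hx
    obtain ⟨l, rfl⟩ := List.getLast?_eq_some_iff.1 hx
    cases x with
    | false => rfl
    | true =>
      have := hpre l (List.prefix_append _ _)
      simp at hcount
      omega
  obtain ⟨m, rfl⟩ | ⟨m, A, D, hA, hD, hlen, -, -, rfl⟩ :=
    exists_eq_codePath (n := n) (s := 0) (t := 0) hlast (by omega) (by omega)
  · simp [List.count_replicate] at htrue
    omega
  · have hm : m = 0 := by
      have := hpre (List.replicate m false) (List.prefix_append _ _)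
      simpa [List.count_replicate] using this
    subst hm
    refine ⟨A, D, hA, hD, (staysAbove_codePath hA hD hlen le_rfl n.zero_le).1 ?_, rfl⟩
    intro q hq
    simpa using hpre q hq

/-- The Lalanne–Kreweras map `L` is a size-preserving involution on Dyck paths: for every
Dyck `n`-path `P`, `L P` is a Dyck `n`-path and `L (L P) = P`. -/
theorem lmap_involution (n : ℕ) (p : List Bool) (hp : IsDyckN n p) :
    IsDyckN n (Lmap p) ∧ Lmap (Lmap p) = p := by
  obtain rfl | hn := n.eq_zero_or_pos
  · obtain ⟨⟨hcount, hpre⟩, htrue⟩ := hp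
    obtain rfl : p = [] := by
      rw [← List.length_eq_zero_iff, ← List.count_true_add_count_false]
      omega
    have hnil : Lmap [] = [] := by decide
    exact ⟨hnil ▸ ⟨⟨hcount, hpre⟩, htrue⟩, by rw [hnil, hnil]⟩
  · obtain ⟨A, D, hA, hD, hDA, rfl⟩ := hp.exists_code hn
    have hlen := hDA.length_eq.symm
    have hlen' := length_codeCompl hA hD hlen
    rw [Lmap_codePath hA hD hlen hn, pathOfCode_eq_codePath hlen',
      Lmap_codePath (isCode_codeCompl _ _ _) (isCode_codeCompl _ _ _) hlen' hn,
      codeCompl_codeCompl hA, codeCompl_codeCompl hD, pathOfCode_eq_codePath hlen]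
    exact ⟨isDyckN_codePath (isCode_codeCompl _ _ _) (isCode_codeCompl _ _ _)
      (forall₂_codeCompl hA hD hDA), rfl⟩
end

section
/- Every nonintersecting path pair of size n+1 contains exactly n minimal diagonals. -/
/-- The vertices `(x, y)` of an `NE`-path started at the origin (`x` counts `E` steps,
`y` counts `N` steps). -/
def pathVertices (Q : List Bool) : List (ℕ × ℕ) :=
  (List.range (Q.length + 1)).map (fun j => ((Q.take j).count false, (Q.take j).count true))

/-- The largest height at which the path `Q` visits horizontal coordinate `x`; this is
the height of the `E` step of `Q` from `x` to `x + 1` (when there is one). -/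
def maxHeightAt (Q : List Bool) (x : ℕ) : ℕ :=
  (((pathVertices Q).filter (fun v => v.1 == x)).map Prod.snd).foldr max 0

/-- The unit square `[x, x+1] × [y, y+1]` is a cell of the region enclosed by the path
pair `P`: it lies weakly below the upper path and weakly above the lower path. -/
def IsCell (P : List Bool × List Bool) (x y : ℕ) : Prop :=
  x < P.1.count false ∧ maxHeightAt P.2 x ≤ y ∧ y + 1 ≤ maxHeightAt P.1 x

/-- The lattice point `v` is a vertex of (one of the two paths of) the path pair `P`. -/
def OnPair (P : List Bool × List Bool) (v : ℕ × ℕ) : Prop :=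
  v ∈ pathVertices P.1 ∨ v ∈ pathVertices P.2

/-- The slope-1 segment from `(x, y)` to `(x + t, y + t)` is a minimal diagonal of the
path pair `P`: it joins two distinct vertices of the paths and lies strictly inside the
enclosed region except at its endpoints (each unit square along it is a cell, and no
interior lattice point of it lies on the paths). -/
def IsMinDiag (P : List Bool × List Bool) (x y t : ℕ) : Prop :=
  1 ≤ t ∧ OnPair P (x, y) ∧ OnPair P (x + t, y + t) ∧
  (∀ s < t, IsCell P (x + s) (y + s)) ∧
  (∀ s, 0 < s → s < t → ¬OnPair P (x + s, y + s))

lemma count_false_take_add_count_true_take (Q : List Bool) (k : ℕ) :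
    (Q.take k).count false + (Q.take k).count true = min k Q.length := by
  rw [List.count_false_add_count_true, List.length_take]

/-- The number of `N` steps among the first `k` steps grows by at most one with each step. -/
lemma count_true_take_succ (Q : List Bool) (k : ℕ) :
    (Q.take (k + 1)).count true = (Q.take k).count true ∨
      (Q.take (k + 1)).count true = (Q.take k).count true + 1 := by
  rw [List.take_add_one, List.count_append]
  rcases h : Q[k]? with _ | b
  · simp
  · cases b <;> simp

lemma count_take_le_count_take (Q : List Bool) (b : Bool) {j k : ℕ} (h : j ≤ k) :
    (Q.take j).count b ≤ (Q.take k).count b :=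
  (List.take_prefix_take_left h).sublist.count_le b

lemma mem_pathVertices_iff (Q : List Bool) (x y : ℕ) :
    (x, y) ∈ pathVertices Q ↔ x + y ≤ Q.length ∧ (Q.take (x + y)).count true = y := by
  simp only [pathVertices, List.mem_map, List.mem_range, Prod.mk.injEq]
  constructor
  · rintro ⟨j, hj, hx, hy⟩
    have := count_false_take_add_count_true_take Q j
    obtain rfl : x + y = j := by omega
    exact ⟨by omega, hy⟩
  · rintro ⟨h, hy⟩
    have := count_false_take_add_count_true_take Q (x + y)
    exact ⟨x + y, by omega, by omega, hy⟩

lemma succ_le_foldr_max_iff (l : List ℕ) (a : ℕ) :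
    a + 1 ≤ l.foldr max 0 ↔ ∃ b ∈ l, a + 1 ≤ b := by
  induction l with
  | nil => simp
  | cons c l ih => rw [List.foldr_cons, le_max_iff, ih]; simp

lemma succ_le_maxHeightAt_iff_exists (Q : List Bool) (x y : ℕ) :
    y + 1 ≤ maxHeightAt Q x ↔ ∃ h, (x, h) ∈ pathVertices Q ∧ y + 1 ≤ h := by
  rw [maxHeightAt, succ_le_foldr_max_iff]
  simp

/-- Some vertex of the path with horizontal coordinate `x` lies above height `y` exactly when
the path has made more than `y` steps `N` after `x + y + 1` steps. -/
lemma succ_le_maxHeightAt_iff (Q : List Bool) {x : ℕ} (y : ℕ) (hx : x < Q.count false) :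
    y + 1 ≤ maxHeightAt Q x ↔ y + 1 ≤ (Q.take (x + y + 1)).count true := by
  rw [succ_le_maxHeightAt_iff_exists]
  constructor
  · rintro ⟨h, hv, hy⟩
    rw [mem_pathVertices_iff] at hv
    have h₁ := count_false_take_add_count_true_take Q (x + h)
    have h₂ := count_false_take_add_count_true_take Q (x + y + 1)
    have := count_take_le_count_take Q false (show x + y + 1 ≤ x + h by omega)
    omega
  · intro hy
    have htotal := count_false_take_add_count_true_take Q Q.length
    rw [List.take_length, min_self] at htotal
    -- the last index at which the path has made at most `x` steps `E`
    set k := Nat.findGreatest (fun k => (Q.take k).count false ≤ x) Q.length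
    have hle : k ≤ Q.length := Nat.findGreatest_le _
    have hkx : (Q.take k).count false ≤ x :=
      Nat.findGreatest_spec (P := fun k => (Q.take k).count false ≤ x) (Nat.zero_le _) (by simp)
    have hlt : k < Q.length := by
      refine lt_of_le_of_ne hle fun h => ?_
      rw [h, List.take_length] at hkx
      omega
    have hsucc : ¬ (Q.take (k + 1)).count false ≤ x :=
      Nat.findGreatest_is_greatest (P := fun k => (Q.take k).count false ≤ x)
        (Nat.lt_succ_self k) hlt
    have h₁ := count_false_take_add_count_true_take Q k
    have h₂ := count_false_take_add_count_true_take Q (k + 1)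
    have h₃ := count_false_take_add_count_true_take Q (x + y + 1)
    have h₄ := count_true_take_succ Q k
    have hyk : x + y + 1 ≤ k := by
      by_contra hcon
      have := count_take_le_count_take Q false (show k + 1 ≤ x + y + 1 by omega)
      omega
    have := count_take_le_count_take Q true hyk
    refine ⟨(Q.take k).count true, ?_, by omega⟩
    rw [mem_pathVertices_iff]
    have hxk : x + (Q.take k).count true = k := by omega
    exact ⟨by omega, by rw [hxk]⟩

/-- The height functions of a path pair: `U k` and `L k` are the numbers of `N` steps among the
first `k` steps of the upper and of the lower path. -/
structure HeightPair (m : ℕ) (U L : ℕ → ℕ) : Prop where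
  upper_zero : U 0 = 0
  lower_zero : L 0 = 0
  upper_succ : ∀ k, U (k + 1) = U k ∨ U (k + 1) = U k + 1
  lower_succ : ∀ k, L (k + 1) = L k ∨ L (k + 1) = L k + 1
  lower_lt_upper : ∀ k, 0 < k → k < m → L k < U k
  eq_of_le : ∀ k, m ≤ k → L k = U k

lemma IsPathPair.heightPair {m : ℕ} {P : List Bool × List Bool} (hP : IsPathPair m P) :
    HeightPair m (fun k => (P.1.take k).count true) (fun k => (P.2.take k).count true) where
  upper_zero := by simp
  lower_zero := by simp
  upper_succ := count_true_take_succ P.1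
  lower_succ := count_true_take_succ P.2
  lower_lt_upper := hP.2.2.2
  eq_of_le k hk := by
    obtain ⟨h₁, h₂, h, -⟩ := hP
    simp only [List.take_of_length_le (h₁.trans_le hk), List.take_of_length_le (h₂.trans_le hk), h]

lemma IsPathPair.onPair_iff {m : ℕ} {P : List Bool × List Bool} (hP : IsPathPair m P)
    (x y : ℕ) : OnPair P (x, y) ↔ x + y ≤ m ∧
      ((P.1.take (x + y)).count true = y ∨ (P.2.take (x + y)).count true = y) := by
  rw [OnPair, mem_pathVertices_iff, mem_pathVertices_iff, hP.1, hP.2.1, and_or_left]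

lemma IsPathPair.isCell_iff {m : ℕ} {P : List Bool × List Bool} (hP : IsPathPair m P)
    (x y : ℕ) : IsCell P x y ↔ (P.2.take (x + y + 1)).count true ≤ y ∧
      y < (P.1.take (x + y + 1)).count true := by
  have h₁ := count_false_take_add_count_true_take P.1 P.1.length
  have h₂ := count_false_take_add_count_true_take P.2 P.2.length
  rw [List.take_length, min_self] at h₁ h₂
  have hcount : P.1.count false = P.2.count false := by
    have := hP.1; have := hP.2.1; have := hP.2.2.1; omega
  rw [IsCell]
  constructor
  · rintro ⟨hx, hlow, hup⟩
    rw [succ_le_maxHeightAt_iff _ _ hx] at hup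
    have := succ_le_maxHeightAt_iff P.2 y (hcount ▸ hx)
    omega
  · rintro ⟨hlow, hup⟩
    have hx : x < P.2.count false := by
      have hlt : x + y + 1 < m := by
        by_contra hcon
        have := hP.heightPair.eq_of_le (x + y + 1) (by omega)
        omega
      have := count_false_take_add_count_true_take P.2 (x + y + 1)
      have := (List.take_sublist (x + y + 1) P.2).count_le false
      have := hP.2.1
      omega
    have := succ_le_maxHeightAt_iff P.2 y hx
    have := succ_le_maxHeightAt_iff P.1 y (hcount ▸ hx)
    omega

namespace HeightPair

variable {m : ℕ} {U L : ℕ → ℕ}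

/-- Walking north-east from the lower left corner of a cell, one stays inside the region until
a vertex of one of the paths is reached. -/
lemma exists_first_vertex (h : HeightPair m U L) {x y : ℕ}
    (hcell : L (x + y + 1) ≤ y ∧ y < U (x + y + 1)) :
    ∃ t, 1 ≤ t ∧
      (x + t + (y + t) ≤ m ∧ (U (x + t + (y + t)) = y + t ∨ L (x + t + (y + t)) = y + t)) ∧
      (∀ s < t, L (x + s + (y + s) + 1) ≤ y + s ∧ y + s < U (x + s + (y + s) + 1)) ∧
      ∀ s, 0 < s → s < t → ¬ (x + s + (y + s) ≤ m ∧
        (U (x + s + (y + s)) = y + s ∨ L (x + s + (y + s)) = y + s)) := by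
  set On : ℕ → Prop := fun t => x + t + (y + t) ≤ m ∧
    (U (x + t + (y + t)) = y + t ∨ L (x + t + (y + t)) = y + t) with hOn
  set Cell : ℕ → Prop := fun s =>
    L (x + s + (y + s) + 1) ≤ y + s ∧ y + s < U (x + s + (y + s) + 1) with hCell
  have hstep : ∀ s, Cell s → ¬ On (s + 1) → Cell (s + 1) := by
    intro s hs hon
    simp only [hOn, hCell] at hs hon ⊢
    have hlt : x + s + (y + s) + 1 < m := by
      by_contra hcon
      have := h.eq_of_le (x + s + (y + s) + 1) (by omega)
      omega
    rw [show x + (s + 1) + (y + (s + 1)) = x + s + (y + s) + 1 + 1 by omega] at hon ⊢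
    have := h.upper_succ (x + s + (y + s) + 1)
    have := h.lower_succ (x + s + (y + s) + 1)
    have := h.upper_succ (x + s + (y + s) + 1 + 1)
    have := h.lower_succ (x + s + (y + s) + 1 + 1)
    omega
  have hrun : ∀ t, (∀ s, 0 < s → s < t → ¬ On s) → ∀ s < t, Cell s := by
    intro t ht s
    induction s with
    | zero => exact fun _ => hcell
    | succ s ih => exact fun hs => hstep s (ih (by omega)) (ht _ (by omega) hs)
  have hex : ∃ t, 1 ≤ t ∧ On t := by
    by_contra! hcon
    have hm : Cell m := hrun (m + 1) (fun s hs _ => hcon s hs) m (by omega)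
    have := h.eq_of_le (x + m + (y + m) + 1) (by omega)
    simp only [hCell] at hm
    omega
  classical
  have hmin : ∀ s, 0 < s → s < Nat.find hex → ¬ On s := fun s hs hlt hon =>
    Nat.find_min hex hlt ⟨hs, hon⟩
  exact ⟨Nat.find hex, (Nat.find_spec hex).1, (Nat.find_spec hex).2, hrun _ hmin, hmin⟩

end HeightPair

lemma card_filter_step_eq (U : ℕ → ℕ) (h0 : U 0 = 0)
    (hs : ∀ k, U (k + 1) = U k ∨ U (k + 1) = U k + 1) (m : ℕ) :
    ((Finset.range m).filter fun k => U (k + 1) = U k + 1).card = U m := by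
  induction m with
  | zero => simp [h0]
  | succ m ih =>
    rw [Finset.range_add_one, Finset.filter_insert]
    split_ifs with h
    · rw [Finset.card_insert_of_notMem (by simp), ih, h]
    · have := hs m
      omega

lemma card_filter_flat_add (L : ℕ → ℕ) (h0 : L 0 = 0)
    (hs : ∀ k, L (k + 1) = L k ∨ L (k + 1) = L k + 1) (m : ℕ) :
    ((Finset.range m).filter fun k => L (k + 1) = L k).card + L m = m := by
  rw [← card_filter_step_eq L h0 hs m]
  have hfilter : (Finset.range m).filter (fun k => L (k + 1) = L k + 1) =
      (Finset.range m).filter (fun k => ¬ L (k + 1) = L k) :=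
    Finset.filter_congr fun k _ => by have := hs k; omega
  rw [hfilter, Finset.card_filter_add_card_filter_not, Finset.card_range]

namespace HeightPair

variable {m : ℕ} {U L : ℕ → ℕ}

lemma upper_le (h : HeightPair m U L) (k : ℕ) : U k ≤ k := by
  induction k with
  | zero => exact h.upper_zero.le
  | succ k ih => have := h.upper_succ k; omega

lemma lower_le (h : HeightPair m U L) (k : ℕ) : L k ≤ k := by
  induction k with
  | zero => exact h.lower_zero.le
  | succ k ih => have := h.lower_succ k; omega

/-- The vertices of a path pair of size at least two that are lower left corners of a cell: the
initial points of the `N` steps of the upper path and of the `E` steps of the lower path, the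
common starting point being counted once. -/
lemma ncard_corners {n : ℕ} (h : HeightPair (n + 1) U L) (hn : 0 < n) :
    {v : ℕ × ℕ | (v.1 + v.2 ≤ n + 1 ∧ (U (v.1 + v.2) = v.2 ∨ L (v.1 + v.2) = v.2)) ∧
      L (v.1 + v.2 + 1) ≤ v.2 ∧ v.2 < U (v.1 + v.2 + 1)}.ncard = n := by
  set A := ((Finset.range (n + 1)).filter fun k => U (k + 1) = U k + 1).image
    fun k => (k - U k, U k) with hA
  set B := ((Finset.range (n + 1)).filter fun k => L (k + 1) = L k).image
    fun k => (k - L k, L k) with hB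
  have hone := h.lower_lt_upper 1 one_pos (by omega)
  have hU1 := h.upper_succ 0
  have hL1 := h.lower_succ 0
  have hU0 := h.upper_zero
  have hL0 := h.lower_zero
  rw [zero_add] at hU1 hL1
  have hmemA (x y : ℕ) : (x, y) ∈ A ↔
      x + y < n + 1 ∧ U (x + y) = y ∧ U (x + y + 1) = y + 1 := by
    simp only [hA, Finset.mem_image, Finset.mem_filter, Finset.mem_range, Prod.mk.injEq]
    constructor
    · rintro ⟨k, ⟨hk, hs⟩, hx, hy⟩
      have := h.upper_le k
      obtain rfl : x + y = k := by omega
      omega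
    · rintro ⟨hk, hy, hs⟩
      exact ⟨x + y, by omega, by omega, hy⟩
  have hmemB (x y : ℕ) : (x, y) ∈ B ↔
      x + y < n + 1 ∧ L (x + y) = y ∧ L (x + y + 1) = y := by
    simp only [hB, Finset.mem_image, Finset.mem_filter, Finset.mem_range, Prod.mk.injEq]
    constructor
    · rintro ⟨k, ⟨hk, hs⟩, hx, hy⟩
      have := h.lower_le k
      obtain rfl : x + y = k := by omega
      omega
    · rintro ⟨hk, hy, hs⟩
      exact ⟨x + y, by omega, by omega, hy⟩
  have hset : {v : ℕ × ℕ | (v.1 + v.2 ≤ n + 1 ∧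
      (U (v.1 + v.2) = v.2 ∨ L (v.1 + v.2) = v.2)) ∧
      L (v.1 + v.2 + 1) ≤ v.2 ∧ v.2 < U (v.1 + v.2 + 1)} = ((A ∪ B : Finset (ℕ × ℕ)) : Set _) := by
    ext ⟨x, y⟩
    rw [Finset.mem_coe, Finset.mem_union, hmemA, hmemB, Set.mem_ofPred_eq]
    have hUs := h.upper_succ (x + y)
    have hLs := h.lower_succ (x + y)
    have hend := h.eq_of_le (x + y + 1)
    have hlt := h.lower_lt_upper (x + y)
    have hlt' := h.lower_lt_upper (x + y + 1)
    rcases Nat.eq_zero_or_pos (x + y) with h0 | hpos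
    · simp only [h0, zero_add] at *
      omega
    · dsimp only
      omega
  have hinter : A ∩ B = {(0, 0)} := by
    ext ⟨x, y⟩
    rw [Finset.mem_inter, hmemA, hmemB, Finset.mem_singleton, Prod.mk.injEq]
    have hlt := h.lower_lt_upper (x + y)
    constructor
    · omega
    · rintro ⟨rfl, rfl⟩
      simp only [add_zero, zero_add]
      omega
  have hcardA : A.card = U (n + 1) := by
    rw [hA, Finset.card_image_of_injective, card_filter_step_eq U hU0 h.upper_succ]
    intro i j hij
    have := h.upper_le i
    have := h.upper_le j
    simp only [Prod.mk.injEq] at hij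
    omega
  have hcardB : B.card + L (n + 1) = n + 1 := by
    rw [hB, Finset.card_image_of_injective, card_filter_flat_add L hL0 h.lower_succ]
    intro i j hij
    have := h.lower_le i
    have := h.lower_le j
    simp only [Prod.mk.injEq] at hij
    omega
  rw [hset, Set.ncard_coe_finset]
  have hcard := Finset.card_union_add_card_inter A B
  rw [hinter, Finset.card_singleton] at hcard
  have := h.eq_of_le (n + 1) le_rfl
  omega

end HeightPair

/-- Minimal diagonals are determined by their lower left endpoints, which are the vertices of the
path pair that are lower left corners of a cell. -/
lemma IsPathPair.ncard_minDiags_eq {m : ℕ} {P : List Bool × List Bool} (hP : IsPathPair m P) :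
    {d : ℕ × ℕ × ℕ | IsMinDiag P d.1 d.2.1 d.2.2}.ncard =
      {v : ℕ × ℕ | OnPair P v ∧ IsCell P v.1 v.2}.ncard := by
  refine Set.ncard_congr (fun d _ => (d.1, d.2.1)) ?_ ?_ ?_
  · rintro ⟨x, y, t⟩ ⟨ht, hon, -, hcell, -⟩
    exact ⟨hon, hcell 0 ht⟩
  · rintro ⟨x, y, t⟩ ⟨x', y', t'⟩ ⟨ht, -, hend, -, hmin⟩ ⟨ht', -, hend', -, hmin'⟩ heq
    obtain ⟨rfl, rfl⟩ := Prod.mk.inj heq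
    rcases lt_trichotomy t t' with hlt | rfl | hlt
    · exact absurd hend (hmin' t ht hlt)
    · rfl
    · exact absurd hend' (hmin t' ht' hlt)
  · rintro ⟨x, y⟩ ⟨hon, hcell⟩
    obtain ⟨t, ht, hend, hcells, hmin⟩ :=
      hP.heightPair.exists_first_vertex ((hP.isCell_iff x y).1 hcell)
    exact ⟨(x, y, t), ⟨ht, hon, (hP.onPair_iff _ _).2 hend,
      fun s hs => (hP.isCell_iff _ _).2 (hcells s hs),
      fun s hs hst => (hP.onPair_iff _ _).not.2 (hmin s hs hst)⟩, rfl⟩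

/-- Every nonintersecting path pair of size `n + 1` contains exactly `n` minimal
diagonals. -/
theorem card_minDiags (n : ℕ) (P : List Bool × List Bool) (hP : IsPathPair (n+1) P) :
    {d : ℕ × ℕ × ℕ | IsMinDiag P d.1 d.2.1 d.2.2}.ncard = n := by
  rw [hP.ncard_minDiags_eq]
  rcases Nat.eq_zero_or_pos n with rfl | hn
  · have hempty : {v : ℕ × ℕ | OnPair P v ∧ IsCell P v.1 v.2} = ∅ := by
      refine Set.eq_empty_of_forall_notMem fun v hv => ?_
      have hcell := (hP.isCell_iff _ _).1 hv.2
      have := hP.heightPair.eq_of_le (v.1 + v.2 + 1) (by omega)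
      omega
    rw [hempty, Set.ncard_empty]
  · rw [← hP.heightPair.ncard_corners hn]
    congr 1
    ext ⟨x, y⟩
    exact and_congr (hP.onPair_iff x y) (hP.isCell_iff x y)
end

section
/- For a Dyck n-path P, let h be the list of labels of the first downstep of each occurrence of dd (downsteps labelled left to right) and t the list of labels of the first upstep of each occurrence of uu (upsteps labelled left to right), and let r be their common length. Then the permutation (1,2,...,n)σ_1σ_2⋯σ_r, where σ_i = s_{h_i}s_{h_i−1}⋯s_{t_i} and s_j is the adjacent transposition interchanging j and j+1, equals the unique 321-avoiding permutation π of {1,...,n} whose excedance code is (h, t), i.e., π(t_i) = h_i + 1 for 1 ≤ i ≤ r, π(i) > i exactly at the positions t_1,...,t_r, and the remaining values of π appear in increasing order. -/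
/-- The adjacent transposition `s j` interchanging `j` and `j + 1`. -/
def sTrans (j : ℕ) : Equiv.Perm ℕ := Equiv.swap j (j+1)

/-- `σ = s_h · s_{h-1} ⋯ s_t` (the product being performed left to right on one-line
notation, i.e. the composite `s_h ∘ s_{h-1} ∘ ⋯ ∘ s_t`). -/
def sigmaSeg (h t : ℕ) : Equiv.Perm ℕ :=
  (((List.range' t (h + 1 - t)).reverse).map sTrans).prod

/-- The Mansour–Deng–Du bijection `M`: with `h = lkA p` and `t = lkD p`, the image is the
permutation `(1, 2, …, n) σ_1 σ_2 ⋯ σ_r` (operations performed left to right), where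
`σ_i = s_{h_i} s_{h_i - 1} ⋯ s_{t_i}`. -/
def Mmap (p : List Bool) : Equiv.Perm ℕ :=
  (List.zipWith sigmaSeg (lkA p) (lkD p)).prod

/-! ### The action of a segment and of a product of segments -/

theorem sigmaSeg_succ {h t : ℕ} (hth : t ≤ h + 1) :
    sigmaSeg (h + 1) t = sTrans (h + 1) * sigmaSeg h t := by
  have e : h + 1 + 1 - t = (h + 1 - t) + 1 := by omega
  have e' : t + (h + 1 - t) = h + 1 := by omega
  simp [sigmaSeg, e, List.range'_concat, e']

/-- For `t ≤ h + 1`, `sigmaSeg h t` is the cycle `t ↦ h + 1`, `x ↦ x - 1` for `t < x ≤ h + 1`. -/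
theorem sigmaSeg_apply {h t : ℕ} (hth : t ≤ h + 1) (x : ℕ) :
    sigmaSeg h t x = if x = t then h + 1 else if t < x ∧ x ≤ h + 1 then x - 1 else x := by
  induction h generalizing x with
  | zero =>
    interval_cases t
    · simp only [sigmaSeg, sTrans, Equiv.swap_apply_def, List.range'_one, List.reverse_singleton,
        List.map_singleton, List.prod_singleton, Nat.zero_add, Nat.sub_zero]
      split_ifs <;> omega
    · simp only [sigmaSeg, Nat.zero_add, Nat.sub_self, List.range'_zero, List.reverse_nil,
        List.map_nil, List.prod_nil, Equiv.Perm.coe_one, id_eq]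
      split_ifs <;> omega
  | succ h ih =>
    rcases Nat.lt_or_ge (h + 1) t with hlt | hle
    · have e : h + 1 + 1 - t = 0 := by omega
      simp only [sigmaSeg, e, List.range'_zero, List.reverse_nil, List.map_nil, List.prod_nil,
        Equiv.Perm.coe_one, id_eq]
      split_ifs <;> omega
    · rw [sigmaSeg_succ hle, Equiv.Perm.mul_apply, ih hle, sTrans, Equiv.swap_apply_def]
      split_ifs <;> omega

/-- The product `σ₁ ⋯ σᵣ` of the segments with upper ends `H` and lower ends `T`. -/
def segProd (H T : List ℕ) : Equiv.Perm ℕ := (List.zipWith sigmaSeg H T).prod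

theorem segProd_cons (h t : ℕ) (H T : List ℕ) :
    segProd (h :: H) (t :: T) = sigmaSeg h t * segProd H T := by
  simp [segProd]

theorem segProd_apply_of_lt {H T : List ℕ} (hle : List.Forall₂ (· ≤ ·) T H) {x : ℕ}
    (hx : ∀ t ∈ T, x < t) : segProd H T x = x := by
  induction hle with
  | nil => simp [segProd]
  | @cons t h T H hth _ ih =>
    simp only [List.mem_cons, forall_eq_or_imp] at hx
    rw [segProd_cons, Equiv.Perm.mul_apply, ih hx.2, sigmaSeg_apply (by omega)]
    split_ifs <;> omega

theorem segProd_apply_of_gt {H T : List ℕ} (hle : List.Forall₂ (· ≤ ·) T H) {x : ℕ}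
    (hx : ∀ h ∈ H, h + 1 < x) : segProd H T x = x := by
  induction hle with
  | nil => simp [segProd]
  | @cons t h T H hth _ ih =>
    simp only [List.mem_cons, forall_eq_or_imp] at hx
    rw [segProd_cons, Equiv.Perm.mul_apply, ih hx.2, sigmaSeg_apply (by omega)]
    split_ifs <;> omega

theorem segProd_apply_getD {H T : List ℕ} (hle : List.Forall₂ (· ≤ ·) T H)
    (hT : T.Pairwise (· < ·)) (hH : H.Pairwise (· < ·)) (i : ℕ) (hi : i < H.length) :
    segProd H T (T.getD i 0) = H.getD i 0 + 1 := by
  induction hle generalizing i with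
  | nil => simp at hi
  | @cons t h T H hth hle ih =>
    rw [List.pairwise_cons] at hT hH
    rw [segProd_cons, Equiv.Perm.mul_apply]
    cases i with
    | zero =>
      rw [List.getD_cons_zero, List.getD_cons_zero, segProd_apply_of_lt hle hT.1,
        sigmaSeg_apply (by omega), if_pos rfl]
    | succ i =>
      have hi' : i < H.length := by simpa using hi
      rw [List.getD_cons_succ, List.getD_cons_succ, ih hT.2 hH.2 i hi', sigmaSeg_apply (by omega)]
      have : h < H.getD i 0 := by
        rw [List.getD_eq_getElem _ _ hi']
        exact hH.1 _ (List.getElem_mem hi')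
      split_ifs <;> omega

theorem segProd_apply_le {H T : List ℕ} (hle : List.Forall₂ (· ≤ ·) T H)
    (hT : T.Pairwise (· < ·)) {x : ℕ} (hx : x ∉ T) : segProd H T x ≤ x := by
  induction hle with
  | nil => simp [segProd]
  | @cons t h T H hth hle ih =>
    rw [List.pairwise_cons] at hT
    simp only [List.mem_cons, not_or] at hx
    have hfix : ∀ y ≤ t, segProd H T y = y := fun y hy =>
      segProd_apply_of_lt hle fun s hs => hy.trans_lt (hT.1 s hs)
    have hx' := ih hT.2 hx.2
    have hne : segProd H T x ≠ t := fun h' =>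
      hx.1 ((segProd H T).injective (h'.trans (hfix t le_rfl).symm))
    rw [segProd_cons, Equiv.Perm.mul_apply, sigmaSeg_apply (by omega), if_neg hne]
    split_ifs <;> omega

theorem segProd_lt_segProd {H T : List ℕ} (hle : List.Forall₂ (· ≤ ·) T H)
    (hT : T.Pairwise (· < ·)) {x y : ℕ} (hx : x ∉ T) (hy : y ∉ T) (hxy : x < y) :
    segProd H T x < segProd H T y := by
  induction hle with
  | nil => simpa [segProd] using hxy
  | @cons t h T H hth hle ih =>
    rw [List.pairwise_cons] at hT
    simp only [List.mem_cons, not_or] at hx hy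
    have hfix : segProd H T t = t := segProd_apply_of_lt hle hT.1
    have hlt := ih hT.2 hx.2 hy.2
    have hne : ∀ z, z ≠ t → segProd H T z ≠ t := fun z hz h' =>
      hz ((segProd H T).injective (h'.trans hfix.symm))
    have hxt := hne x hx.1
    have hyt := hne y hy.1
    rw [segProd_cons, Equiv.Perm.mul_apply, Equiv.Perm.mul_apply, sigmaSeg_apply (by omega),
      sigmaSeg_apply (by omega), if_neg hxt, if_neg hyt]
    split_ifs <;> omega

/-! ### The labels of `uu` and `dd` in a Dyck path -/

theorem adjPositions_singleton (a b x : Bool) : adjPositions a b [x] = [] := by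
  simp [adjPositions]

theorem adjPositions_concat (a b : Bool) (r : List Bool) (x : Bool) :
    adjPositions a b (r ++ [x]) = (List.range r.length).filter
      (fun j => (r ++ [x])[j]? == some a && (r ++ [x])[j + 1]? == some b) := by
  simp [adjPositions, List.range_succ]

theorem adjPositions_concat_concat (a b : Bool) (r : List Bool) (x c : Bool) :
    adjPositions a b (r ++ [x] ++ [c]) =
      adjPositions a b (r ++ [x]) ++ if x = a ∧ c = b then [r.length] else [] := by
  rw [adjPositions_concat, adjPositions_concat, List.length_append, List.length_singleton,
    List.range_succ, List.filter_append]
  congr 1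
  · refine List.filter_congr fun j hj => ?_
    rw [List.mem_range] at hj
    rw [List.getElem?_append_left (l₁ := r ++ [x]) (by simp; omega),
      List.getElem?_append_left (l₁ := r ++ [x]) (by simp; omega)]
  · by_cases h : x = a <;> by_cases h' : c = b <;> simp [h, h']

theorem map_count_take_adjPositions_concat (a b : Bool) (q : List Bool) (c : Bool) :
    (adjPositions a b q).map (fun j => ((q ++ [c]).take (j + 1)).count a) =
      (adjPositions a b q).map (fun j => (q.take (j + 1)).count a) := by
  refine List.map_congr_left fun j hj => ?_
  have hj' : j < q.length := List.mem_range.1 (List.mem_filter.1 hj).1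
  rw [List.take_append_of_le_length (by omega)]

theorem lkA_concat_concat (r : List Bool) (x c : Bool) :
    lkA (r ++ [x] ++ [c]) = lkA (r ++ [x]) ++
      if x = false ∧ c = false then [(r ++ [x]).count false] else [] := by
  rw [lkA, adjPositions_concat_concat, List.map_append, map_count_take_adjPositions_concat, lkA]
  split_ifs <;> simp [List.take_append, List.take_of_length_le]

theorem lkD_concat_concat (r : List Bool) (x c : Bool) :
    lkD (r ++ [x] ++ [c]) = lkD (r ++ [x]) ++
      if x = true ∧ c = true then [(r ++ [x]).count true] else [] := by
  rw [lkD, adjPositions_concat_concat, List.map_append, map_count_take_adjPositions_concat, lkD]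
  split_ifs <;> simp [List.take_append, List.take_of_length_le]

/-- The relations between the labels `H` of `dd` and `T` of `uu` in a prefix of a Dyck path with
`u` upsteps, `d` downsteps and last step `x`. -/
structure LabelInvariant (H T : List ℕ) (u d : ℕ) (x : Bool) : Prop where
  pairwise_up : T.Pairwise (· < ·)
  pairwise_down : H.Pairwise (· < ·)
  up_bounds : ∀ t ∈ T, 1 ≤ t ∧ t < u
  down_bounds : ∀ h ∈ H, 1 ≤ h ∧ h < d
  length_eq : T.length + d + x.toNat = u + H.length
  getD_le : ∀ i < H.length, T.getD i 0 ≤ H.getD i 0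
  getD_up_le : ∀ i < T.length, T.getD i 0 + T.length ≤ u + i

namespace LabelInvariant

variable {H T : List ℕ} {u d : ℕ}

theorem up_up (hI : LabelInvariant H T u d true) (hu : d < u) :
    LabelInvariant H (T ++ [u]) (u + 1) d true where
  pairwise_up := by
    rw [List.pairwise_append]
    exact ⟨hI.pairwise_up, List.pairwise_singleton _ _,
      by simpa using fun t ht => (hI.up_bounds t ht).2⟩
  pairwise_down := hI.pairwise_down
  up_bounds t ht := by
    rcases List.mem_append.1 ht with ht | ht
    · have := hI.up_bounds t ht
      omega
    · rw [List.mem_singleton] at ht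
      omega
  down_bounds := hI.down_bounds
  length_eq := by
    have := hI.length_eq
    simp only [List.length_append, List.length_singleton]
    omega
  getD_le i hi := by
    have h1 := hI.length_eq
    have h2 := hI.getD_le i hi
    simp only [Bool.toNat_true] at h1
    rwa [List.getD_append _ _ _ _ (by omega)]
  getD_up_le i hi := by
    simp only [List.length_append, List.length_singleton] at hi ⊢
    rcases Nat.lt_or_ge i T.length with hlt | hge
    · have := hI.getD_up_le i hlt
      rw [List.getD_append _ _ _ _ hlt]
      omega
    · obtain rfl : i = T.length := by omega
      rw [List.getD_append_right _ _ _ _ le_rfl]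
      simp
      omega

theorem down_up (hI : LabelInvariant H T u d false) : LabelInvariant H T (u + 1) d true where
  pairwise_up := hI.pairwise_up
  pairwise_down := hI.pairwise_down
  up_bounds t ht := by
    have := hI.up_bounds t ht
    omega
  down_bounds := hI.down_bounds
  length_eq := by
    have := hI.length_eq
    simp only [Bool.toNat_true, Bool.toNat_false] at this ⊢
    omega
  getD_le := hI.getD_le
  getD_up_le i hi := by
    have := hI.getD_up_le i hi
    omega

theorem up_down (hI : LabelInvariant H T u d true) : LabelInvariant H T u (d + 1) false where
  pairwise_up := hI.pairwise_up
  pairwise_down := hI.pairwise_down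
  up_bounds := hI.up_bounds
  down_bounds h hh := by
    have := hI.down_bounds h hh
    omega
  length_eq := by
    have := hI.length_eq
    simp only [Bool.toNat_true, Bool.toNat_false] at this ⊢
    omega
  getD_le := hI.getD_le
  getD_up_le := hI.getD_up_le

theorem down_down (hI : LabelInvariant H T u d false) (hd : 1 ≤ d) (hu : d < u) :
    LabelInvariant (H ++ [d]) T u (d + 1) false where
  pairwise_up := hI.pairwise_up
  pairwise_down := by
    rw [List.pairwise_append]
    exact ⟨hI.pairwise_down, List.pairwise_singleton _ _,
      by simpa using fun h hh => (hI.down_bounds h hh).2⟩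
  up_bounds := hI.up_bounds
  down_bounds h hh := by
    rcases List.mem_append.1 hh with hh | hh
    · have := hI.down_bounds h hh
      omega
    · rw [List.mem_singleton] at hh
      omega
  length_eq := by
    have := hI.length_eq
    simp only [List.length_append, List.length_singleton]
    omega
  getD_le i hi := by
    simp only [List.length_append, List.length_singleton] at hi
    rcases Nat.lt_or_ge i H.length with hlt | hge
    · rw [List.getD_append _ _ _ _ hlt]
      exact hI.getD_le i hlt
    · obtain rfl : i = H.length := by omega
      have h1 := hI.length_eq
      simp only [Bool.toNat_false] at h1
      have h2 := hI.getD_up_le H.length (by omega)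
      rw [List.getD_append_right _ _ _ _ le_rfl]
      simp only [Nat.sub_self, List.getD_cons_zero]
      omega
  getD_up_le := hI.getD_up_le

end LabelInvariant

theorem labelInvariant_concat (r : List Bool) (x : Bool)
    (hr : ∀ q : List Bool, q <+: r ++ [x] → q.count false ≤ q.count true) :
    LabelInvariant (lkA (r ++ [x])) (lkD (r ++ [x])) ((r ++ [x]).count true)
      ((r ++ [x]).count false) x := by
  induction r using List.reverseRecOn generalizing x with
  | nil =>
    have hx := hr [x] (by simp)
    cases x
    · simp at hx
    · constructor <;> simp [lkA, lkD, adjPositions_singleton]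
  | append_singleton r y ih =>
    have hpre : ∀ q : List Bool, q <+: r ++ [y] → q.count false ≤ q.count true := fun q hq =>
      hr q (hq.trans (List.prefix_append _ _))
    have hI := ih y hpre
    have hfull := hr _ (List.prefix_refl _)
    have hinit := hpre r (List.prefix_append _ _)
    rw [lkA_concat_concat, lkD_concat_concat, List.count_append (l₁ := r ++ [y]),
      List.count_append (l₁ := r ++ [y])]
    rw [List.count_append (l₁ := r ++ [y]), List.count_append (l₁ := r ++ [y])] at hfull
    cases y <;> cases x <;>
      simp only [List.count_singleton, beq_self_eq_true, if_true, and_self, List.append_nil,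
        Bool.false_eq_true, reduceCtorEq, and_false, false_and, if_false, beq_iff_eq,
        Nat.add_zero] at hfull ⊢
    · exact hI.down_down (by simp) (by omega)
    · exact hI.down_up
    · exact hI.up_down
    · exact hI.up_up (by simp; omega)

/-! ### Uniqueness -/

/-- Two permutations of a set of naturals that agree on a set `S` and are increasing off `S`
cannot first differ at a point where the first one is smaller. -/
theorem not_lt_of_eq_below {s S : Set ℕ} {f g : ℕ → ℕ} (hf : Set.BijOn f s s)
    (hg : Set.BijOn g s s) (hS : ∀ i ∈ s, i ∈ S → f i = g i)
    (hgm : ∀ i j, i ∈ s → j ∈ s → i < j → i ∉ S → j ∉ S → g i < g j)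
    {i : ℕ} (hi : i ∈ s) (ih : ∀ j < i, j ∈ s → f j = g j) : ¬f i < g i := by
  intro hlt
  have hiS : i ∉ S := fun h => hlt.ne (hS i hi h)
  obtain ⟨j, hj, hji⟩ := hg.surjOn (hf.mapsTo hi)
  have hne : f j ≠ g j := fun h => by
    obtain rfl : j = i := hf.injOn hj hi (h.trans hji)
    omega
  have hjS : j ∉ S := fun h => hne (hS j hj h)
  rcases lt_trichotomy j i with h | h | h
  · exact hne (ih j h hj)
  · subst h
    omega
  · have := hgm i j hi hj h hiS hjS
    omega

theorem eqOn_of_eq_of_increasing_off {s S : Set ℕ} {f g : ℕ → ℕ} (hf : Set.BijOn f s s)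
    (hg : Set.BijOn g s s) (hS : ∀ i ∈ s, i ∈ S → f i = g i)
    (hfm : ∀ i j, i ∈ s → j ∈ s → i < j → i ∉ S → j ∉ S → f i < f j)
    (hgm : ∀ i j, i ∈ s → j ∈ s → i < j → i ∉ S → j ∉ S → g i < g j) : Set.EqOn f g s := by
  intro i
  induction i using Nat.strong_induction_on with
  | _ i ih =>
    intro hi
    have h1 := not_lt_of_eq_below hf hg hS hgm hi ih
    have h2 := not_lt_of_eq_below hg hf (fun i h h' => (hS i h h').symm) hfm hi
      fun j hj hjs => (ih j hj hjs).symm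
    omega

/-- A union of two increasing subsequences contains no `321` pattern. -/
theorem av321_of_increasing_on_off {n : ℕ} {π : ℕ → ℕ} {S : Set ℕ}
    (hon : ∀ i ∈ S, ∀ j ∈ S, i < j → π i < π j)
    (hoff : ∀ i j, i ∉ S → j ∉ S → i < j → π i < π j) : Av321 n π := by
  rintro i j k - hij hjk - ⟨hkj, hji⟩
  by_cases hi : i ∈ S <;> by_cases hj : j ∈ S <;> by_cases hk : k ∈ S
  · have := hon i hi j hj hij
    omega
  · have := hon i hi j hj hij
    omega
  · have := hon i hi k hk (hij.trans hjk)
    omega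
  · have := hoff j k hj hk hjk
    omega
  · have := hon j hj k hk hjk
    omega
  · have := hoff i k hi hk (hij.trans hjk)
    omega
  · have := hoff i j hi hj hij
    omega
  · have := hoff i j hi hj hij
    omega

theorem permOn_segProd {n : ℕ} {H T : List ℕ} (hle : List.Forall₂ (· ≤ ·) T H)
    (hT : ∀ t ∈ T, 1 ≤ t) (hH : ∀ h ∈ H, h < n) : PermOn n (segProd H T) := by
  have hfix : ∀ i, i ∉ Set.Icc 1 n → segProd H T i = i := by
    intro i hi
    rw [Set.mem_Icc] at hi
    rcases Nat.lt_or_ge i 1 with h | h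
    · exact segProd_apply_of_lt hle fun t ht => h.trans_le (hT t ht)
    · refine segProd_apply_of_gt hle fun h' hh' => ?_
      have := hH h' hh'
      omega
  refine ⟨⟨fun i hi => ?_, (segProd H T).injective.injOn, fun i hi => ?_⟩, hfix⟩
  · by_contra hcon
    have := (segProd H T).injective (hfix _ hcon)
    rw [this] at hcon
    exact hcon hi
  · refine ⟨(segProd H T).symm i, ?_, by simp⟩
    by_contra hcon
    have := hfix _ hcon
    rw [Equiv.apply_symm_apply] at this
    exact hcon (this ▸ hi)

/-- The labels of the `dd`s and `uu`s of a Dyck `n`-path form a valid excedance code. -/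
theorem IsDyckN.code_valid {n : ℕ} {p : List Bool} (hp : IsDyckN n p) :
    List.Forall₂ (· ≤ ·) (lkD p) (lkA p) ∧ (lkD p).Pairwise (· < ·) ∧
      (lkA p).Pairwise (· < ·) ∧ (∀ t ∈ lkD p, 1 ≤ t) ∧ ∀ h ∈ lkA p, h < n := by
  obtain ⟨⟨hcount, hpre⟩, hn⟩ := hp
  rcases List.eq_nil_or_concat p with rfl | ⟨r, x, rfl⟩
  · simp [lkA, lkD, adjPositions]
  · rw [List.concat_eq_append] at *
    have hI := labelInvariant_concat r x hpre
    have hx : x = false := by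
      have hr := hpre r (List.prefix_append _ _)
      cases x
      · rfl
      · simp at hcount
        omega
    have hlen : (lkD (r ++ [x])).length = (lkA (r ++ [x])).length := by
      have := hI.length_eq
      rw [hcount, hx] at this
      rw [hx]
      simp only [Bool.toNat_false] at this
      omega
    refine ⟨List.forall₂_iff_get.2 ⟨hlen, fun i h₁ h₂ => ?_⟩, hI.pairwise_up, hI.pairwise_down,
      fun t ht => (hI.up_bounds t ht).1, fun h hh => ?_⟩
    · have := hI.getD_le i h₂
      rwa [List.getD_eq_getElem _ _ h₁, List.getD_eq_getElem _ _ h₂] at this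
    · rw [← hn, hcount]
      exact (hI.down_bounds h hh).2

/-- For a Dyck `n`-path `P` with `h = lkA P` (labels of the first downstep of each `dd`)
and `t = lkD P` (labels of the first upstep of each `uu`), the permutation
`(1, 2, …, n) σ_1 σ_2 ⋯ σ_r`, where `σ_i = s_{h_i} s_{h_i - 1} ⋯ s_{t_i}`, equals the
unique 321-avoiding permutation `π` of `{1, …, n}` whose excedance code is `(h, t)`:
`π (t_i) = h_i + 1` for `1 ≤ i ≤ r`, `π i > i` exactly at the positions `t_1, …, t_r`,
and the remaining values of `π` appear in increasing order. -/
theorem mmap_eq_perm_of_excedance_code (n : ℕ) (p : List Bool) (hp : IsDyckN n p) :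
    (PermOn n (Mmap p) ∧ Av321 n (Mmap p) ∧
      (∀ i < (lkA p).length, Mmap p ((lkD p).getD i 0) = (lkA p).getD i 0 + 1) ∧
      (∀ i ∈ Set.Icc 1 n, (i < Mmap p i ↔ i ∈ lkD p)) ∧
      (∀ i j, i ∈ Set.Icc 1 n → j ∈ Set.Icc 1 n → i < j → i ∉ lkD p → j ∉ lkD p →
        Mmap p i < Mmap p j)) ∧
    (∀ π : ℕ → ℕ, PermOn n π → Av321 n π →
      (∀ i < (lkA p).length, π ((lkD p).getD i 0) = (lkA p).getD i 0 + 1) →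
      (∀ i ∈ Set.Icc 1 n, (i < π i ↔ i ∈ lkD p)) →
      (∀ i j, i ∈ Set.Icc 1 n → j ∈ Set.Icc 1 n → i < j → i ∉ lkD p → j ∉ lkD p →
        π i < π j) →
      ∀ i ∈ Set.Icc 1 n, π i = Mmap p i) := by
  obtain ⟨hle, hT, hH, hT1, hHn⟩ := hp.code_valid
  have hM : Mmap p = segProd (lkA p) (lkD p) := rfl
  have hlen : (lkD p).length = (lkA p).length := hle.length_eq
  have hval := segProd_apply_getD hle hT hH
  have hidx : ∀ t ∈ lkD p, ∃ i < (lkA p).length, (lkD p).getD i 0 = t := by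
    intro t ht
    obtain ⟨i, hi, rfl⟩ := List.mem_iff_getElem.1 ht
    exact ⟨i, hlen ▸ hi, List.getD_eq_getElem _ _ hi⟩
  have hperm := permOn_segProd hle hT1 hHn
  have hoff : ∀ i j, i ∉ lkD p → j ∉ lkD p → i < j →
      segProd (lkA p) (lkD p) i < segProd (lkA p) (lkD p) j := fun i j hi hj hij =>
    segProd_lt_segProd hle hT hi hj hij
  have hon : ∀ i ∈ lkD p, ∀ j ∈ lkD p, i < j →
      segProd (lkA p) (lkD p) i < segProd (lkA p) (lkD p) j := by
    intro s hs t ht hst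
    obtain ⟨i, hi, rfl⟩ := hidx s hs
    obtain ⟨j, hj, rfl⟩ := hidx t ht
    rw [hval i hi, hval j hj]
    rw [List.getD_eq_getElem _ _ (hlen ▸ hi), List.getD_eq_getElem _ _ (hlen ▸ hj)] at hst
    rw [List.getD_eq_getElem _ _ hi, List.getD_eq_getElem _ _ hj]
    have hij : i < j := (hT.sortedLT.strictMono_get.lt_iff_lt
      (a := ⟨i, hlen ▸ hi⟩) (b := ⟨j, hlen ▸ hj⟩)).1 hst
    have := List.pairwise_iff_getElem.1 hH i j hi hj hij
    omega
  rw [hM]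
  refine ⟨⟨hperm, av321_of_increasing_on_off (S := {i | i ∈ lkD p}) hon hoff, hval, ?_,
    fun i j _ _ hij hi hj => hoff i j hi hj hij⟩, ?_⟩
  · intro i _
    constructor
    · intro hlt
      by_contra hi
      exact absurd (segProd_apply_le hle hT hi) (by omega)
    · intro hi
      obtain ⟨k, hk, rfl⟩ := hidx i hi
      rw [hval k hk, List.getD_eq_getElem _ _ hk, List.getD_eq_getElem _ _ (hlen ▸ hk)]
      exact Nat.lt_succ_of_le ((List.forall₂_iff_get.1 hle).2 k (hlen ▸ hk) hk)
  · intro π hπ _ hπval _ hπoff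
    refine eqOn_of_eq_of_increasing_off (S := {i | i ∈ lkD p}) hπ.1 hperm.1 (fun i _ hi => ?_)
      hπoff fun i j _ _ hij hi hj => hoff i j hi hj hij
    obtain ⟨k, hk, rfl⟩ := hidx i hi
    rw [hπval k hk, hval k hk]
end
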